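/- arXiv:2407.10314 — 2 statements merged into one kernel-verified Lean document; each statement's English description precedes it below -/
import Mathlib

section
/- For every n ≥ 3 there exists λ ∈ (0,1) such that every convex body B in ℝⁿ that is the image of a 1-symmetric convex body under an invertible affine transformation satisfies N(B, λ·B) ≤ 2ⁿ: there is a finite set T ⊆ ℝⁿ with |T| ≤ 2ⁿ such that B ⊆ ⋃_{t ∈ T} (t + λ·B). -/
open scoped Pointwise

/-- A labelling of the vertices of the cube by coordinate directions such that every face with
nonempty set `S` of fixed coordinates has a vertex labelled by an element of `S`. -/
theorem exists_vertex_labelling {n : ℕ} (hn : 0 < n) :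
    ∃ σ : (Fin n → Bool) → Fin n, ∀ S : Set (Fin n), S.Nonempty → ∀ s : Fin n → Bool,
      ∃ ε : Fin n → Bool, (∀ i ∈ S, ε i = s i) ∧ σ ε ∈ S := by
  classical
  let o : Fin n := ⟨0, hn⟩
  have first_change : ∀ ε : Fin n → Bool, ∃ k : Fin n,
      ((∀ j, ε j = ε o) ∧ k = o) ∨ (ε k ≠ ε o ∧ ∀ j < k, ε j = ε o) := by
    intro ε
    by_cases h : ∀ j, ε j = ε o
    · exact ⟨o, Or.inl ⟨h, rfl⟩⟩
    · push Not at h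
      obtain ⟨k, hk, hmin⟩ := wellFounded_lt.has_min {j : Fin n | ε j ≠ ε o} h
      exact ⟨k, Or.inr ⟨hk, fun j hj => by_contra fun hne => hmin j hne hj⟩⟩
  choose σ hσ using first_change
  have label_eq : ∀ (ε : Fin n → Bool) (k : Fin n), ε k ≠ ε o → (∀ j < k, ε j = ε o) →
      σ ε = k := by
    intro ε k hk hlt
    rcases hσ ε with ⟨h, -⟩ | ⟨h1, h2⟩
    · exact absurd (h k) hk
    · rcases lt_trichotomy (σ ε) k with h | h | h
      · exact absurd (hlt _ h) h1
      · exact h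
      · exact absurd (h2 _ h) hk
  refine ⟨σ, fun S hS s => ?_⟩
  by_cases ho : o ∈ S
  · by_cases hc : ∃ j, j ∈ S ∧ s j ≠ s o
    · obtain ⟨k, ⟨hkS, hk⟩, hmin⟩ :=
        wellFounded_lt.has_min {j : Fin n | j ∈ S ∧ s j ≠ s o} hc
      refine ⟨fun i => if i ∈ S then s i else s o, fun i hi => if_pos hi, ?_⟩
      rw [label_eq _ k]
      · exact hkS
      · simpa [hkS, ho] using hk
      · intro j hj
        by_cases hjS : j ∈ S
        · simp only [hjS, ho, if_true]
          exact by_contra fun hne => hmin j ⟨hjS, hne⟩ hj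
        · simp [hjS]
    · push Not at hc
      refine ⟨fun _ => s o, fun i hi => (hc i hi).symm, ?_⟩
      rcases hσ (fun _ => s o) with ⟨-, h⟩ | ⟨h, -⟩
      · rw [h]; exact ho
      · exact absurd rfl h
  · obtain ⟨k, hkS, hmin⟩ := wellFounded_lt.has_min S hS
    refine ⟨fun i => if i ∈ S then s i else !(s k), fun i hi => if_pos hi, ?_⟩
    rw [label_eq _ k]
    · exact hkS
    · simp [hkS, ho]
    · intro j hj
      have : j ∉ S := fun h => hmin j h hj
      simp [this, ho]

/-- Among `n + 1` consecutive intervals of length `w`, one contains none of `n` given numbers. -/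
theorem exists_gap {n : ℕ} (a : Fin n → ℝ) {w : ℝ} (hw : 0 < w) :
    ∃ τ : ℝ, 0 ≤ τ ∧ τ ≤ w * n ∧ ∀ i, a i ≤ τ ∨ τ + w < a i := by
  by_contra! h
  have hk : ∀ k : Fin (n + 1), ∃ i, w * (k : ℕ) < a i ∧ a i ≤ w * (k : ℕ) + w := fun k =>
    h (w * (k : ℕ)) (by positivity)
      (mul_le_mul_of_nonneg_left (by exact_mod_cast Nat.lt_succ_iff.mp k.2) hw.le)
  choose f hf using hk
  have key : ∀ k l : Fin (n + 1), k < l → f k ≠ f l := by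
    intro k l hkl hfe
    have h1 := (hf k).2
    have h2 := (hf l).1
    rw [hfe] at h1
    have h3 : ((k : ℕ) : ℝ) + 1 ≤ ((l : ℕ) : ℝ) := by exact_mod_cast hkl
    nlinarith
  have hinj : Function.Injective f := by
    intro k l hfe
    rcases lt_trichotomy k l with hlt | heq | hgt
    · exact absurd hfe (key _ _ hlt)
    · exact heq
    · exact absurd hfe.symm (key _ _ hgt)
  simpa using Fintype.card_le_of_injective f hinj

/-- Invariance under permutations and sign changes of the coordinates. -/
def IsSymmInvariant {n : ℕ} (B : Set (Fin n → ℝ)) : Prop :=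
  ∀ x ∈ B, ∀ σ : Equiv.Perm (Fin n), ∀ ε : Fin n → ℝ,
    (∀ i, ε i = 1 ∨ ε i = -1) → (fun i => ε i * x (σ i)) ∈ B

theorem IsSymmInvariant.perm {n : ℕ} {B : Set (Fin n → ℝ)} (h : IsSymmInvariant B)
    {x : Fin n → ℝ} (hx : x ∈ B) (σ : Equiv.Perm (Fin n)) : (fun i => x (σ i)) ∈ B := by
  simpa using h x hx σ (fun _ => 1) (fun _ => Or.inl rfl)

/-- A convex set invariant under sign changes is solid. -/
theorem IsSymmInvariant.mem_of_abs_le {n : ℕ} {B : Set (Fin n → ℝ)} (h : IsSymmInvariant B)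
    (hc : Convex ℝ B) {x y : Fin n → ℝ} (hx : x ∈ B) (hy : ∀ i, |y i| ≤ |x i|) : y ∈ B := by
  classical
  have key : ∀ s : Finset (Fin n), (fun i => if i ∈ s then y i else x i) ∈ B := by
    intro s
    induction s using Finset.induction_on with
    | empty => simpa using hx
    | insert a s ha ih =>
      have hflip := h _ ih (Equiv.refl _) (fun i => if i = a then -1 else 1)
        (fun i => by by_cases hi : i = a <;> simp [hi])
      obtain ⟨u, v, hu, hv, huv, he⟩ : ∃ u v : ℝ, 0 ≤ u ∧ 0 ≤ v ∧ u + v = 1 ∧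
          y a = u * x a + v * (-x a) := by
        by_cases h0 : x a = 0
        · refine ⟨1, 0, by norm_num, le_rfl, by norm_num, ?_⟩
          have := hy a
          rw [h0, abs_zero] at this
          simp [h0, abs_nonpos_iff.mp this]
        · have hq : |y a / x a| ≤ 1 := by
            rw [abs_div]
            exact div_le_one_of_le₀ (hy a) (abs_nonneg _)
          obtain ⟨h1, h2⟩ := abs_le.mp hq
          refine ⟨(1 + y a / x a) / 2, (1 - y a / x a) / 2, by linarith, by linarith, by ring, ?_⟩
          field_simp
          ring
      convert hc ih hflip hu hv huv using 1
      funext i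
      by_cases hi : i = a
      · subst hi
        simp [ha, he]
      · by_cases his : i ∈ s
        · simp [hi, his]
          linear_combination (-y i) * huv
        · simp [hi, his]
          linear_combination (-x i) * huv
  simpa using key Finset.univ

/-- Mass can be moved from a large coordinate `p` to all coordinates outside `S` without leaving
a convex permutation invariant set. -/
theorem IsSymmInvariant.transfer_mem {n : ℕ} {B : Set (Fin n → ℝ)} (h : IsSymmInvariant B)
    (hc : Convex ℝ B) {x : Fin n → ℝ} (hx : x ∈ B) {S : Finset (Fin n)} {p : Fin n} (hp : p ∈ S)
    {c : ℝ} (hc0 : 0 ≤ c) {g : ℝ} (hg : 0 < g) (hgap : ∀ j ∉ S, x j + g ≤ x p)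
    (hcg : n * c ≤ g) :
    (fun i => if i = p then x p - (Sᶜ.card : ℝ) * c else if i ∈ S then x i else x i + c) ∈ B := by
  classical
  have hpos : ∀ j ∉ S, 0 < x p - x j := fun j hj => by linarith [hgap j hj]
  have hsum : ∑ j ∈ Sᶜ, c / (x p - x j) ≤ 1 := by
    calc ∑ j ∈ Sᶜ, c / (x p - x j) ≤ ∑ j ∈ Sᶜ, c / g := by
          refine Finset.sum_le_sum fun j hj => ?_
          have hj' : j ∉ S := by simpa using hj
          exact div_le_div_of_nonneg_left hc0 hg (by linarith [hgap j hj'])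
      _ = (Sᶜ.card : ℝ) * (c / g) := by simp
      _ ≤ n * (c / g) := by
          refine mul_le_mul_of_nonneg_right ?_ (by positivity)
          exact_mod_cast (Finset.card_le_univ _).trans_eq (Fintype.card_fin n)
      _ ≤ 1 := by rw [← mul_div_assoc]; exact div_le_one_of_le₀ hcg hg.le
  have hpS : p ∉ Sᶜ := by simpa using hp
  obtain ⟨w, hwp, hw⟩ : ∃ w : Fin n → ℝ, w p = 1 - ∑ j ∈ Sᶜ, c / (x p - x j) ∧
      ∀ j ∈ Sᶜ, w j = c / (x p - x j) :=
    ⟨fun j => if j = p then 1 - ∑ j ∈ Sᶜ, c / (x p - x j) else c / (x p - x j), if_pos rfl,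
      fun j hj => if_neg fun hjp : j = p => hpS (hjp ▸ hj)⟩
  have hmem := hc.sum_mem (t := insert p Sᶜ) (w := w)
    (z := fun j i => x (Equiv.swap p j i)) ?_ ?_ (fun j _ => h.perm hx _)
  · convert hmem using 1
    funext i
    rw [Finset.sum_insert hpS, Pi.add_apply, Finset.sum_apply]
    simp only [Pi.smul_apply, smul_eq_mul, Equiv.swap_self, Equiv.refl_apply]
    rw [hwp, Finset.sum_congr rfl fun j hj => congrArg (· * x (Equiv.swap p j i)) (hw j hj)]
    have rewrite_sum : (1 - ∑ j ∈ Sᶜ, c / (x p - x j)) * x i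
        + ∑ j ∈ Sᶜ, c / (x p - x j) * x (Equiv.swap p j i)
        = x i + ∑ j ∈ Sᶜ, c / (x p - x j) * (x (Equiv.swap p j i) - x i) := by
      simp only [mul_sub, Finset.sum_sub_distrib, ← Finset.sum_mul]
      ring
    rw [rewrite_sum]
    by_cases hip : i = p
    · subst hip
      have : ∀ j ∈ Sᶜ, c / (x i - x j) * (x (Equiv.swap i j i) - x i) = -c := by
        intro j hj
        have := (hpos j (by simpa using hj)).ne'
        rw [Equiv.swap_apply_left]
        field_simp
        ring
      rw [Finset.sum_congr rfl this]
      simp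
      ring
    · by_cases hiS : i ∈ S
      · rw [Finset.sum_eq_zero]
        · simp [hip, hiS]
        · intro j hj
          have hij : i ≠ j := fun hij => (by simpa using hj : j ∉ S) (hij ▸ hiS)
          rw [Equiv.swap_apply_of_ne_of_ne hip hij]
          ring
      · rw [Finset.sum_eq_single i]
        · have := (hpos i hiS).ne'
          simp only [hip, hiS, if_false, Equiv.swap_apply_right]
          field_simp
        · intro j _ hji
          rw [Equiv.swap_apply_of_ne_of_ne hip hji.symm]
          ring
        · intro hi
          exact absurd (by simpa using hiS) hi
  · intro j hj
    rcases Finset.mem_insert.mp hj with rfl | hj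
    · rw [hwp]
      linarith
    · rw [hw j hj]
      exact div_nonneg hc0 (hpos j (by simpa using hj)).le
  · rw [Finset.sum_insert hpS, hwp, Finset.sum_congr rfl hw]
    ring

theorem IsSymmInvariant.abs_mem {n : ℕ} {B : Set (Fin n → ℝ)} (h : IsSymmInvariant B)
    (hc : Convex ℝ B) {x : Fin n → ℝ} (hx : x ∈ B) : (fun i => |x i|) ∈ B :=
  h.mem_of_abs_le hc hx fun i => by simp

theorem mem_smul_of_abs_le {n : ℕ} {B : Set (Fin n → ℝ)} (h : IsSymmInvariant B)
    (hc : Convex ℝ B) {l : ℝ} (hl : 0 < l) {z y : Fin n → ℝ} (hz : z ∈ B)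
    (hy : ∀ i, |y i| ≤ l * |z i|) : y ∈ l • B := by
  refine ⟨l⁻¹ • y, h.mem_of_abs_le hc hz fun i => ?_, by simp [smul_smul, hl.ne']⟩
  rw [Pi.smul_apply, smul_eq_mul, abs_mul, abs_of_pos (inv_pos.mpr hl)]
  rw [inv_mul_le_iff₀ hl]
  exact hy i

/-- The real sign attached to a Boolean. -/
def boolSign (b : Bool) : ℝ := if b then 1 else -1

theorem abs_boolSign (b : Bool) : |boolSign b| = 1 := by cases b <;> simp [boolSign]

theorem abs_sub_boolSign_mul {a d : ℝ} (hd : d ≤ |a|) :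
    |a - boolSign (decide (0 ≤ a)) * d| = |a| - d := by
  by_cases ha : 0 ≤ a
  · rw [abs_of_nonneg ha] at hd ⊢
    simp only [boolSign, ha, decide_true, if_true, one_mul]
    exact abs_of_nonneg (by linarith)
  · rw [abs_of_neg (not_le.mp ha)] at hd ⊢
    simp only [boolSign, ha, decide_false, Bool.false_eq_true, if_false]
    rw [abs_of_nonpos (by linarith)]
    ring

theorem exists_covering_of_normalized {n : ℕ} (hn : 0 < n) :
    ∃ l : ℝ, l ∈ Set.Ioo (0 : ℝ) 1 ∧
      ∀ B : Set (Fin n → ℝ), Convex ℝ B → IsSymmInvariant B →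
        (∀ x ∈ B, ∀ i, |x i| ≤ 1) → (∀ i, Pi.single i 1 ∈ B) →
        ∃ T : Finset (Fin n → ℝ), T.card ≤ 2 ^ n ∧ ∀ x ∈ B, ∃ t ∈ T, x - t ∈ l • B := by
  classical
  obtain ⟨σ, hσ⟩ := exists_vertex_labelling hn
  have hN : (1 : ℝ) ≤ n := by exact_mod_cast hn
  obtain ⟨δ, hδ⟩ : ∃ δ : ℝ, δ = 1 / (8 * (n : ℝ) ^ 2) := ⟨_, rfl⟩
  obtain ⟨η, hη⟩ : ∃ η : ℝ, η = 1 / (4 * (n : ℝ)) := ⟨_, rfl⟩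
  have hδ0 : 0 < δ := by rw [hδ]; positivity
  have hη0 : 0 < η := by rw [hη]; positivity
  have hηn : n * η = 1 / 4 := by rw [hη]; field_simp
  have hδn : n * δ * n = 1 / 8 := by rw [hδ]; field_simp
  have hη1 : η ≤ 1 / 4 := by nlinarith
  have hnδ : δ ≤ n * δ := by nlinarith
  have hδ1 : δ ≤ 1 / 8 := by nlinarith
  have hηδ : 0 < η * δ := mul_pos hη0 hδ0
  have hηδ' : η * δ ≤ 1 / 4 * δ := mul_le_mul_of_nonneg_right hη1 hδ0.le
  refine ⟨1 - η * δ / 2, ⟨by linarith, by linarith⟩, fun B hc hs hb he => ?_⟩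
  set d : (Fin n → Bool) → Fin n → ℝ :=
    fun ε i => boolSign (ε i) * (if i = σ ε then δ else η * δ) with hd
  refine ⟨Finset.univ.image d, Finset.card_image_le.trans (by simp), fun x hx => ?_⟩
  have hl0 : 0 < 1 - η * δ / 2 := by linarith
  obtain ⟨τ, hτ0, hτn, hτ⟩ := exists_gap (fun i => |x i|) (w := 2 * δ) (by linarith)
  set S : Finset (Fin n) := Finset.univ.filter fun i => τ + 2 * δ < |x i| with hS
  have hd_abs : ∀ ε i, |d ε i| ≤ δ := by
    intro ε i
    simp only [hd, abs_mul, abs_boolSign, one_mul]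
    split_ifs
    · exact (abs_of_pos hδ0).le
    · rw [abs_of_pos hηδ]; linarith
  rcases S.eq_empty_or_nonempty with hempty | hne
  · refine ⟨d fun _ => true, Finset.mem_image_of_mem _ (Finset.mem_univ _), ?_⟩
    have hmean : (fun _ => 1 / (n : ℝ)) ∈ B := by
      have := hc.sum_mem (t := Finset.univ) (w := fun _ : Fin n => 1 / (n : ℝ))
        (z := fun i => Pi.single i 1) (fun _ _ => by positivity)
        (by simp; field_simp) (fun i _ => he i)
      convert this using 1
      funext i
      simp [Finset.sum_apply, Pi.single_apply]
    refine mem_smul_of_abs_le hs hc hl0 hmean fun i => ?_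
    have hi : |x i| ≤ τ := by
      refine (hτ i).resolve_right fun hlt => ?_
      have : i ∈ S := by simpa [hS] using hlt
      simp [hempty] at this
    have h1 : |(x - d fun _ => true) i| ≤ |x i| + |d (fun _ => true) i| := abs_sub _ _
    have h2 := hd_abs (fun _ => true) i
    have h3 : (1 : ℝ) / n = 8 * (n * δ) := by rw [hδ]; field_simp
    rw [abs_of_nonneg (by positivity : (0 : ℝ) ≤ 1 / n), h3]
    have h4 : 0 ≤ (1 / 2 - η * δ / 2) * (n * δ) := mul_nonneg (by linarith) (by positivity)
    linarith
  · obtain ⟨ε, hε, hεS⟩ := hσ (S : Set (Fin n)) (by simpa using hne) fun i => decide (0 ≤ x i)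
    refine ⟨d ε, Finset.mem_image_of_mem _ (Finset.mem_univ _), ?_⟩
    have hin : ∀ i ∈ S, τ + 2 * δ < |x i| := fun i hi => by simpa [hS] using hi
    have hout : ∀ i ∉ S, |x i| ≤ τ := fun i hi =>
      (hτ i).resolve_right fun hlt => hi (by simpa [hS] using hlt)
    have hp : σ ε ∈ S := by simpa using hεS
    have hz := hs.transfer_mem hc (hs.abs_mem hc hx) hp (c := 2 * (η * δ)) (by positivity)
      (g := 2 * δ) (by linarith) (fun j hj => by linarith [hout j hj, hin _ hp])
      (by nlinarith)
    refine mem_smul_of_abs_le hs hc hl0 hz fun i => ?_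
    have hxi := hb x hx i
    have hx0 := abs_nonneg (x i)
    by_cases hi : i = σ ε
    · have hiS : i ∈ S := hi ▸ hp
      have hcard : (Sᶜ.card : ℝ) * (2 * (η * δ)) ≤ δ / 2 := by
        have : (Sᶜ.card : ℝ) ≤ n := by
          exact_mod_cast (Finset.card_le_univ _).trans_eq (Fintype.card_fin n)
        have := mul_le_mul_of_nonneg_right this (by positivity : 0 ≤ 2 * (η * δ))
        nlinarith
      have h1 := hin i hiS
      have h2 : |(x - d ε) i| = |x i| - δ := by
        simp only [Pi.sub_apply, hd, ← hi, if_true]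
        rw [hε i hiS]
        exact abs_sub_boolSign_mul (by linarith)
      have h3 : (0 : ℝ) ≤ (Sᶜ.card : ℝ) * (2 * (η * δ)) := by positivity
      simp only [← hi, if_true]
      rw [h2, abs_of_nonneg (a := |x i| - (Sᶜ.card : ℝ) * (2 * (η * δ))) (by linarith)]
      nlinarith
    · by_cases hiS : i ∈ S
      · have h1 := hin i hiS
        have h2 : |(x - d ε) i| = |x i| - η * δ := by
          simp only [Pi.sub_apply, hd, hi, if_false]
          rw [hε i hiS]
          exact abs_sub_boolSign_mul (by linarith)
        simp only [hi, hiS, if_true, if_false, abs_abs]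
        rw [h2]
        nlinarith
      · have h2 : |(x - d ε) i| ≤ |x i| + η * δ := by
          refine (abs_sub _ _).trans_eq ?_
          simp [hd, hi, abs_mul, abs_boolSign, abs_of_pos hη0, abs_of_pos hδ0]
        simp only [hi, hiS, if_false]
        rw [abs_of_nonneg (by positivity : 0 ≤ |x i| + 2 * (η * δ))]
        nlinarith

/-- A 1-symmetric convex body is a dilate of one whose largest coordinate is `1`. -/
theorem exists_normalization {n : ℕ} (hn : 0 < n) {B : Set (Fin n → ℝ)} (hc : Convex ℝ B)
    (hk : IsCompact B) (hi : (interior B).Nonempty) (hs : IsSymmInvariant B) :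
    ∃ r : ℝ, 0 < r ∧ (∀ x ∈ B, ∀ i, |x i| ≤ r) ∧ ∀ i, Pi.single i r ∈ B := by
  classical
  have : Nonempty (Fin n) := ⟨⟨0, hn⟩⟩
  obtain ⟨x, hx, hmax⟩ := hk.exists_isMaxOn (hi.mono interior_subset) continuous_norm.continuousOn
  have hle : ∀ y ∈ B, ∀ i, |y i| ≤ ‖x‖ := fun y hy i =>
    (norm_le_pi_norm y i).trans (hmax hy)
  have hpos : 0 < ‖x‖ := by
    by_contra h0
    have hsub : B ⊆ {0} := fun y hy => by
      have : ‖y‖ ≤ ‖x‖ := hmax hy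
      exact norm_le_zero_iff.mp (this.trans (not_lt.mp h0))
    have := hi.mono (interior_mono hsub)
    rw [interior_singleton] at this
    exact Set.not_nonempty_empty this
  obtain ⟨p, hp⟩ : ∃ p, ‖x‖ ≤ |x p| := by
    by_contra! h
    exact lt_irrefl _ ((pi_norm_lt_iff hpos).mpr h)
  refine ⟨‖x‖, hpos, hle, fun i => ?_⟩
  refine hs.mem_of_abs_le hc (hs.perm hx (Equiv.swap p i)) fun j => ?_
  by_cases hj : j = i
  · subst hj
    simpa using hp
  · simp [hj]

/-- Proposition: for every `n ≥ 3` there is `λ ∈ (0,1)` such that every affine image `B` of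
a 1-symmetric convex body in `ℝⁿ` can be covered by at most `2ⁿ` translates of `λ • B`. -/
theorem stmt_18 {n : ℕ} (hn : 3 ≤ n) :
    ∃ l : ℝ, l ∈ Set.Ioo (0 : ℝ) 1 ∧
      ∀ B : Set (Fin n → ℝ),
        (∃ B' : Set (Fin n → ℝ), Convex ℝ B' ∧ IsCompact B' ∧ (interior B').Nonempty ∧
          (∀ x ∈ B', ∀ σ : Equiv.Perm (Fin n), ∀ ε : Fin n → ℝ,
            (∀ i, ε i = 1 ∨ ε i = -1) → (fun i => ε i * x (σ i)) ∈ B') ∧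
          ∃ T : (Fin n → ℝ) ≃ᵃ[ℝ] (Fin n → ℝ), B = T '' B') →
        ∃ T : Finset (Fin n → ℝ), T.card ≤ 2 ^ n ∧
          ∀ x ∈ B, ∃ t ∈ T, x - t ∈ l • B := by
  classical
  have hn0 : 0 < n := by omega
  obtain ⟨l, hl, hcover⟩ := exists_covering_of_normalized hn0
  refine ⟨l, hl, ?_⟩
  rintro _ ⟨B', hc, hk, hi, hs, A, rfl⟩
  obtain ⟨r, hr, hle, hsingle⟩ := exists_normalization hn0 hc hk hi hs
  obtain ⟨T, hT, hTcover⟩ := hcover {x | r • x ∈ B'} (hc.smul_preimage r)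
    (fun x hx σ ε hε => by
      have := hs _ hx σ ε hε
      simp only [Set.mem_ofPred_eq]
      convert this using 1
      funext i
      simp only [Pi.smul_apply, smul_eq_mul]
      ring)
    (fun x hx i => by
      have := hle _ hx i
      rw [Pi.smul_apply, smul_eq_mul, abs_mul, abs_of_pos hr] at this
      exact le_of_mul_le_mul_left (by linarith) hr)
    (fun i => by
      simp only [Set.mem_ofPred_eq, ← Pi.single_smul, smul_eq_mul, mul_one]
      exact hsingle i)
  refine ⟨T.image fun t => A.linear (r • t) + (1 - l) • A 0, Finset.card_image_le.trans hT, ?_⟩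
  rintro _ ⟨y, hy, rfl⟩
  obtain ⟨t, ht, k, hkB, hkt⟩ := hTcover (r⁻¹ • y) (by simpa [smul_smul, hr.ne'] using hy)
  refine ⟨_, Finset.mem_image_of_mem _ ht, A (r • k), ⟨r • k, hkB, rfl⟩, ?_⟩
  have hA : ∀ v, A v = A.linear v + A 0 := fun v => by
    simpa using A.map_vadd 0 v
  have hyk : y = r • t + l • r • k := by
    have : r⁻¹ • y = t + l • k := by
      rw [show l • k = r⁻¹ • y - t from hkt]; abel
    rw [smul_comm l r k, ← smul_add, ← this, smul_smul, mul_inv_cancel₀ hr.ne', one_smul]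
  rw [hA y, hA (r • k), hyk]
  simp only [map_add, map_smul, smul_add, sub_smul, one_smul]
  abel
end

section
/- For every n ≥ 3 there exists α > 1 such that every convex body K in ℝⁿ that is α-symmetric and is not a parallelepiped (i.e., not the image of the cube [−1,1]ⁿ under an invertible affine transformation) has illumination number at most 2ⁿ − 1. -/
open scoped Pointwise

/-- `K` can be illuminated by at most `m` directions. -/
def Illuminable {n : ℕ} (K : Set (Fin n → ℝ)) (m : ℕ) : Prop :=
  ∃ D : Finset (Fin n → ℝ), D.card ≤ m ∧
    ∀ x ∈ frontier K, ∃ d ∈ D, ∃ ε : ℝ, 0 < ε ∧ x + ε • d ∈ interior K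

theorem continuousLinearMap_eq_dotProduct {n : ℕ} (φ : (Fin n → ℝ) →L[ℝ] ℝ) :
    ∃ g : Fin n → ℝ, ∀ x, φ x = g ⬝ᵥ x := by
  refine ⟨fun i => φ (Pi.single i 1), fun x => ?_⟩
  have h := LinearMap.pi_apply_eq_sum_univ φ.toLinearMap x
  simp only [ContinuousLinearMap.coe_coe] at h
  rw [h, dotProduct]
  refine Finset.sum_congr rfl fun i _ => ?_
  rw [smul_eq_mul, mul_comm]
  congr 2
  ext k
  simp [Pi.single_apply, eq_comm]

theorem Illuminable.of_image {n : ℕ} {K : Set (Fin n → ℝ)} {m : ℕ}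
    (T : (Fin n → ℝ) ≃ᵃ[ℝ] (Fin n → ℝ)) (h : Illuminable (T '' K) m) : Illuminable K m := by
  classical
  obtain ⟨D, hD, hx⟩ := h
  refine ⟨D.image T.symm.linear, Finset.card_image_le.trans hD, fun x hxK => ?_⟩
  let H : (Fin n → ℝ) ≃ₜ (Fin n → ℝ) := T.toContinuousAffineEquiv.toHomeomorph
  have hH : ∀ y, H y = T y := fun y => rfl
  have hf : T x ∈ frontier (T '' K) := by
    have := H.image_frontier K
    rw [show T '' K = H '' K from rfl, ← this]
    exact ⟨x, hxK, rfl⟩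
  obtain ⟨d, hd, ε, hε, hi⟩ := hx _ hf
  refine ⟨T.symm.linear d, Finset.mem_image_of_mem _ hd, ε, hε, ?_⟩
  rw [show T '' K = H '' K from rfl, ← H.image_interior K] at hi
  obtain ⟨y, hy, hye⟩ := hi
  rw [hH] at hye
  have : y = x + ε • T.symm.linear d := by
    apply T.injective
    have hd : T.linear (T.symm.linear d) = d := T.linear.apply_symm_apply d
    have h := T.map_vadd x (ε • T.symm.linear d)
    rw [map_smul, hd, vadd_eq_add, vadd_eq_add, add_comm _ x, add_comm _ (T x)] at h
    rw [hye, h]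
  rwa [← this]

/-- A direction illuminates a boundary point if it makes an obtuse angle with all outer normals. -/
theorem illuminates_of_forall_normal {n : ℕ} {K : Set (Fin n → ℝ)} (hK : Convex ℝ K)
    (hKc : IsCompact K) (h0 : (0 : Fin n → ℝ) ∈ interior K) {x d : Fin n → ℝ} (hx : x ∈ frontier K)
    (h : ∀ f : Fin n → ℝ, f ⬝ᵥ x = 1 → (∀ y ∈ K, f ⬝ᵥ y ≤ 1) → f ⬝ᵥ d < 0) :
    ∃ ε : ℝ, 0 < ε ∧ x + ε • d ∈ interior K := by
  by_contra! hcon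
  have hxK : x ∈ K := hKc.isClosed.frontier_subset hx
  let R : Set (Fin n → ℝ) := (fun ε : ℝ => x + ε • d) '' Set.Ioi 0
  have hR : Convex ℝ R := by
    have : R = (AffineMap.lineMap (k := ℝ) x (x + d)) '' Set.Ioi (0 : ℝ) := by
      ext y
      simp [R, AffineMap.lineMap_apply, add_comm]
    rw [this]
    exact (convex_Ioi 0).affine_image _
  have hdis : Disjoint (interior K) R := by
    rw [Set.disjoint_left]
    rintro _ hy ⟨ε, hε, rfl⟩
    exact hcon ε hε hy
  obtain ⟨φ, u, hu1, hu2⟩ := geometric_hahn_banach_open hK.interior isOpen_interior hR hdis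
  obtain ⟨g, hg⟩ := continuousLinearMap_eq_dotProduct φ
  have hupos : 0 < u := by simpa using hu1 0 h0
  have hle : ∀ y ∈ K, φ y ≤ u := by
    intro y hy
    have hcl : y ∈ closure (interior K) := by
      rw [hK.closure_interior_eq_closure_of_nonempty_interior ⟨0, h0⟩]
      exact subset_closure hy
    exact closure_minimal (t := {y | φ y ≤ u}) (fun z hz => (hu1 z hz).le)
      (isClosed_le φ.continuous continuous_const) hcl
  have hray : ∀ ε : ℝ, 0 < ε → u ≤ φ x + ε * φ d := by
    intro ε hε
    have := hu2 _ ⟨ε, hε, rfl⟩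
    simpa using this
  have hxu : φ x = u := by
    refine le_antisymm (hle x hxK) (le_of_forall_pos_lt_add ?_)
    intro ε hε
    have h1 := hray (ε / (2 * (|φ d| + 1))) (by positivity)
    have h2 : ε / (2 * (|φ d| + 1)) * φ d ≤ ε / 2 := by
      rw [div_mul_eq_mul_div, div_le_div_iff₀ (by positivity) (by positivity)]
      nlinarith [le_abs_self (φ d), mul_le_mul_of_nonneg_left (le_abs_self (φ d)) hε.le]
    linarith
  have hd : 0 ≤ φ d := by
    have := hray 1 one_pos
    linarith
  have := h (u⁻¹ • g) (by rw [smul_dotProduct, ← hg, hxu, smul_eq_mul, inv_mul_cancel₀ hupos.ne'])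
    (fun y hy => by
      rw [smul_dotProduct, ← hg, smul_eq_mul, inv_mul_le_iff₀ hupos, mul_one]
      exact hle y hy)
  rw [smul_dotProduct, ← hg, smul_eq_mul] at this
  have h3 : 0 ≤ u⁻¹ * φ d := by positivity
  linarith

theorem cube_subset_of_support {n : ℕ} {K : Set (Fin n → ℝ)} (hK : Convex ℝ K)
    (hKc : IsClosed K) {s : ℝ} (h : ∀ g : Fin n → ℝ, ∃ y ∈ K, s * ∑ i, |g i| ≤ g ⬝ᵥ y)
    {x : Fin n → ℝ} (hx : ∀ i, |x i| ≤ s) : x ∈ K := by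
  by_contra hxK
  obtain ⟨φ, u, hu1, hu2⟩ := geometric_hahn_banach_closed_point hK hKc hxK
  obtain ⟨g, hg⟩ := continuousLinearMap_eq_dotProduct φ
  obtain ⟨y, hy, hgy⟩ := h g
  have h1 := hu1 y hy
  rw [hg] at h1 hu2
  have h2 : g ⬝ᵥ x ≤ s * ∑ i, |g i| := by
    rw [dotProduct, Finset.mul_sum]
    refine Finset.sum_le_sum fun i _ => ?_
    calc g i * x i ≤ |g i * x i| := le_abs_self _
      _ = |x i| * |g i| := by rw [abs_mul, mul_comm]
      _ ≤ s * |g i| := mul_le_mul_of_nonneg_right (hx i) (abs_nonneg _)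
  linarith

theorem zero_mem_interior_of_cube_subset {n : ℕ} {K : Set (Fin n → ℝ)} {s : ℝ} (hs : 0 < s)
    (h : ∀ x : Fin n → ℝ, (∀ i, |x i| ≤ s) → x ∈ K) : (0 : Fin n → ℝ) ∈ interior K := by
  rw [mem_interior_iff_mem_nhds]
  refine Filter.mem_of_superset (Metric.closedBall_mem_nhds _ hs) fun x hx => h x fun i => ?_
  rw [mem_closedBall_zero_iff] at hx
  exact (norm_le_pi_norm x i).trans hx

theorem exists_labelling {n : ℕ} (hn : 3 ≤ n) :
    ∃ l : (Fin n → Bool) → Fin n, ∀ (S : Finset (Fin n)) (σ : Fin n → Bool), S.Nonempty →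
      S ≠ Finset.univ → ∃ p, p ≠ (fun _ => true) ∧ (∀ i ∈ S, p i = σ i) ∧ l p ∈ S := by
  induction n, hn using Nat.le_induction with
  | base =>
    refine ⟨fun p => if p 0 then (if p 1 then 0 else if p 2 then 0 else 1)
      else if p 1 then (if p 2 then 1 else 2) else if p 2 then 2 else 0, ?_⟩
    decide
  | succ n hn ih =>
    obtain ⟨l, hl⟩ := ih
    let a : Bool → Fin n → Bool := fun h i => !h && decide (i.val = 0)
    have ha : a true ≠ a false := fun h => by
      have := congrFun h ⟨0, by omega⟩
      simp [a] at this
    have hat : ∀ h, a h ≠ fun _ => true := fun h h' => by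
      have := congrFun h' ⟨1, by omega⟩
      simp [a] at this
    have hsel : ∀ p, ∃ h, p ≠ a h := fun p => by
      by_cases h : p = a true
      · exact ⟨false, fun h' => ha (h.symm.trans h')⟩
      · exact ⟨true, h⟩
    refine ⟨fun p => if Fin.tail p = a (p 0) then 0 else (l (Fin.tail p)).succ,
      fun S σ hS hSu => ?_⟩
    let S' : Finset (Fin n) := Finset.univ.filter fun i => i.succ ∈ S
    have hS' : ∀ i, i ∈ S' ↔ i.succ ∈ S := fun i => by simp [S']
    have hne : ∀ (h : Bool) (p : Fin n → Bool), p ≠ (fun _ => true) →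
        (Fin.cons h p : Fin (n + 1) → Bool) ≠ fun _ => true := fun h p hp hc => hp <| by
      ext i
      simpa using congrFun hc i.succ
    by_cases h0 : (0 : Fin (n + 1)) ∈ S
    · rcases S'.eq_empty_or_nonempty with he | hS'n
      · refine ⟨Fin.cons (σ 0) (a (σ 0)), hne _ _ (hat _), fun i hi => ?_, by simpa using h0⟩
        refine Fin.cases (fun _ => by simp) (fun j hj => ?_) i hi
        have := (hS' j).2 hj
        simp [he] at this
      · have hu : S' ≠ Finset.univ := fun hu => hSu <| by
          ext i
          refine Fin.cases (by simpa using h0) (fun j => ?_) i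
          simp [← hS', hu]
        obtain ⟨p, hp, hps, hpl⟩ := hl S' (Fin.tail σ) hS'n hu
        refine ⟨Fin.cons (σ 0) p, hne _ _ hp, fun i hi => ?_, ?_⟩
        · refine Fin.cases (fun _ => by simp) (fun j hj => ?_) i hi
          simpa [Fin.tail] using hps j ((hS' j).2 hj)
        · simp only [Fin.tail_cons, Fin.cons_zero]
          split_ifs
          · exact h0
          · exact (hS' _).1 hpl
    · have hS'n : S'.Nonempty := by
        obtain ⟨i, hi⟩ := hS
        induction i using Fin.cases with
        | zero => exact absurd hi h0
        | succ j => exact ⟨j, (hS' j).2 hi⟩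
      have key : ∀ (h : Bool) (p : Fin n → Bool), p ≠ a h → (∀ i ∈ S', p i = σ i.succ) →
          l p ∈ S' → (∀ i ∈ S, (Fin.cons h p : Fin (n + 1) → Bool) i = σ i) ∧
          (if Fin.tail (Fin.cons h p : Fin (n + 1) → Bool) = a ((Fin.cons h p : Fin (n + 1) → Bool) 0)
            then 0 else (l (Fin.tail (Fin.cons h p : Fin (n + 1) → Bool))).succ) ∈ S := by
        intro h p hp hps hpl
        refine ⟨fun i hi => ?_, ?_⟩
        · refine Fin.cases (fun h => absurd h h0) (fun j hj => ?_) i hi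
          simpa [Fin.tail] using hps j ((hS' j).2 hj)
        · simp only [Fin.tail_cons, Fin.cons_zero, if_neg hp]
          exact (hS' _).1 hpl
      by_cases hu : S' = Finset.univ
      · by_cases hσ : Fin.tail σ = fun _ => true
        · refine ⟨Fin.cons false (Fin.tail σ), fun hc => ?_, key _ _ ?_ (fun _ _ => rfl)
            (by simp [hu])⟩
          · simpa using congrFun hc 0
          · rw [hσ]; exact (hat _).symm
        · obtain ⟨h, hh⟩ := hsel (Fin.tail σ)
          exact ⟨Fin.cons h (Fin.tail σ), hne _ _ hσ, key _ _ hh (fun _ _ => rfl) (by simp [hu])⟩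
      · obtain ⟨p, hp, hps, hpl⟩ := hl S' (Fin.tail σ) hS'n hu
        obtain ⟨h, hh⟩ := hsel p
        exact ⟨Fin.cons h p, hne _ _ hp, key _ _ hh hps hpl⟩

/-- The direction with sign pattern `p`: the coordinate `m` has modulus one, all others have
modulus `δ`, except that a unique negative coordinate has modulus `δ'`. -/
noncomputable def labelledDirection {n : ℕ} (δ δ' : ℝ) (m : Fin n) (p : Fin n → Bool) (i : Fin n) :
    ℝ :=
  (if p i then 1 else -1) * if i = m then 1 else if ∀ k, k ≠ i → p k = true then δ' else δ

/-- `f` is an approximate outer normal at `x` for all rearrangements of `x`. -/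
def NearlyNormal {n : ℕ} (η : ℝ) (x f : Fin n → ℝ) : Prop :=
  f ⬝ᵥ x = 1 ∧ (∀ i, |f i| ≤ 1 + η) ∧ ∀ σ : Equiv.Perm (Fin n), ∑ i, |f i| * |x (σ i)| ≤ 1 + η

theorem NearlyNormal.mul_eq_abs_mul_abs {n : ℕ} {x f : Fin n → ℝ} (h : NearlyNormal 0 x f)
    (i : Fin n) :
    f i * x i = |f i| * |x i| := by
  have h1 := h.2.2 1
  have h2 : ∑ i, (|f i| * |x i| - f i * x i) ≤ 0 := by
    have := h.1
    rw [dotProduct] at this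
    rw [Finset.sum_sub_distrib, this]
    simpa using h1
  have h3 : ∀ j ∈ Finset.univ, 0 ≤ |f j| * |x j| - f j * x j := fun j _ => by
    rw [← abs_mul]; linarith [le_abs_self (f j * x j)]
  have h4 := (Finset.sum_eq_zero_iff_of_nonneg h3).1 (le_antisymm h2 (Finset.sum_nonneg h3)) i
    (Finset.mem_univ i)
  linarith

theorem NearlyNormal.abs_le_abs {n : ℕ} {x f : Fin n → ℝ} (h : NearlyNormal 0 x f) {i j : Fin n}
    (hij : |x j| < |x i|) : |f j| ≤ |f i| := by
  have hne : i ≠ j := by rintro rfl; exact lt_irrefl _ hij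
  have h1 : ∑ k, |f k| * |x k| = 1 := by
    rw [← h.1, dotProduct]
    exact Finset.sum_congr rfl fun k _ => (h.mul_eq_abs_mul_abs k).symm
  have h2 := h.2.2 (Equiv.swap i j)
  have h3 : ∑ k, |f k| * (|x (Equiv.swap i j k)| - |x k|) ≤ 0 := by
    simp only [mul_sub, Finset.sum_sub_distrib]
    linarith
  rw [Fintype.sum_eq_add i j hne] at h3
  · simp only [Equiv.swap_apply_left, Equiv.swap_apply_right] at h3
    by_contra! hlt
    nlinarith
  · rintro k ⟨hki, hkj⟩
    simp [Equiv.swap_apply_of_ne_of_ne hki hkj]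

theorem labelledDirection_mul {n : ℕ} {δ δ' : ℝ} {m : Fin n} {p : Fin n → Bool} {x f : Fin n → ℝ}
    (h : NearlyNormal 0 x f) {i : Fin n} (hx : x i ≠ 0) (hp : p i = decide (x i < 0)) :
    f i * labelledDirection δ δ' m p i =
      -(|f i| * if i = m then 1 else if ∀ k, k ≠ i → p k = true then δ' else δ) := by
  have h1 := h.mul_eq_abs_mul_abs i
  rw [labelledDirection, hp]
  rcases lt_or_gt_of_ne hx with hx | hx
  · have : f i = -|f i| := by
      rw [abs_of_neg hx] at h1
      have : (f i + |f i|) * x i = 0 := by linarith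
      rcases mul_eq_zero.1 this with h | h <;> linarith
    simp only [hx, decide_true, if_true]
    nth_rewrite 1 [this]
    ring
  · have : f i = |f i| := by
      rw [abs_of_pos hx] at h1
      exact mul_right_cancel₀ hx.ne' h1
    simp only [not_lt.2 hx.le, decide_false, Bool.false_eq_true, if_false]
    nth_rewrite 1 [this]
    ring

theorem exists_direction_of_nearlyNormal_zero {n : ℕ} (hn : 2 ≤ n) {l : (Fin n → Bool) → Fin n}
    (hl : ∀ (S : Finset (Fin n)) (σ : Fin n → Bool), S.Nonempty →
      S ≠ Finset.univ → ∃ p, p ≠ (fun _ => true) ∧ (∀ i ∈ S, p i = σ i) ∧ l p ∈ S)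
    {δ δ' ρ : ℝ} (hδ' : 0 < δ') (hδδ' : δ' < δ) (hδ : δ * (2 * n) ≤ 1) (hρ : δ' < δ * ρ)
    {x : Fin n → ℝ} (hx : ∃ i, |x i| ≤ 1 - ρ) :
    ∃ p, p ≠ (fun _ => true) ∧
      ∀ f, NearlyNormal 0 x f → f ⬝ᵥ labelledDirection δ δ' (l p) p < 0 := by
  have hδ0 : 0 < δ := hδ'.trans hδδ'
  have hmag : ∀ (p : Fin n → Bool) (m i : Fin n),
      δ' ≤ if i = m then 1 else if ∀ k, k ≠ i → p k = true then δ' else δ := by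
    intro p m i
    have hn : (1 : ℝ) ≤ n := by exact_mod_cast i.pos
    split_ifs <;> nlinarith
  have hf0 : ∀ f, NearlyNormal 0 x f → ¬ ∀ i, x i ≠ 0 → f i = 0 := fun f hf h => by
    have : f ⬝ᵥ x = 0 := Finset.sum_eq_zero fun i _ => by
      by_cases hxi : x i = 0
      · simp [hxi]
      · simp [h i hxi]
    rw [hf.1] at this
    exact one_ne_zero this
  have hfull : ∀ f, NearlyNormal 0 x f → ∀ (p : Fin n → Bool) (m : Fin n),
      (∀ i, x i ≠ 0 ∧ p i = decide (x i < 0)) →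
      f ⬝ᵥ labelledDirection δ δ' m p < 0 := by
    intro f hf p m hp
    by_contra! hcon
    refine hf0 f hf fun i _ => ?_
    have h1 : ∀ i ∈ Finset.univ, f i * labelledDirection δ δ' m p i ≤ -(δ' * |f i|) := fun i _ => by
      rw [labelledDirection_mul hf (hp i).1 (hp i).2, mul_comm δ']
      exact neg_le_neg (mul_le_mul_of_nonneg_left (hmag p m i) (abs_nonneg _))
    have h2 : 0 ≤ ∑ i, -(δ' * |f i|) := hcon.trans (Finset.sum_le_sum h1)
    rw [Finset.sum_neg_distrib, ← Finset.mul_sum] at h2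
    have h3 : |f i| ≤ ∑ i, |f i| :=
      Finset.single_le_sum (f := fun i => |f i|) (fun i _ => abs_nonneg _) (Finset.mem_univ i)
    have h4 : |f i| ≤ 0 := by nlinarith
    exact abs_nonpos_iff.1 h4
  by_cases hall : ∀ i, x i ≠ 0
  · by_cases hneg : ∀ i, x i < 0
    · obtain ⟨i₀, hi₀⟩ := hx
      obtain ⟨j, -, hj⟩ := Finset.exists_min_image Finset.univ (fun i => |x i|)
        ⟨i₀, Finset.mem_univ _⟩
      replace hj : ∀ i, |x j| ≤ |x i| := fun i => hj i (Finset.mem_univ _)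
      have hS : (Finset.univ.erase j).Nonempty := by
        rw [← Finset.card_pos, Finset.card_erase_of_mem (Finset.mem_univ j), Finset.card_fin]
        omega
      obtain ⟨p, hp, hps, hpl⟩ := hl (Finset.univ.erase j) (fun _ => true) hS
        (fun h => by have := Finset.mem_univ j; rw [← h] at this; simp at this)
      have hps' : ∀ i, i ≠ j → p i = true := fun i hi => hps i (by simpa using hi)
      have hpj : p j = false := by
        by_contra hc
        refine hp (funext fun i => ?_)
        by_cases hi : i = j
        · simpa [hi] using hc
        · exact hps' i hi
      have hlj : l p ≠ j := by simpa using hpl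
      refine ⟨p, hp, fun f hf => ?_⟩
      by_contra! hcon
      have hfn : ∀ i, f i = -|f i| := fun i => by
        have h1 := hf.mul_eq_abs_mul_abs i
        rw [abs_of_neg (hneg i)] at h1
        have : (f i + |f i|) * x i = 0 := by linarith
        rcases mul_eq_zero.1 this with h | h
        · linarith
        · exact absurd h (hall i)
      have hterm : ∀ i ∈ Finset.univ.erase j,
          f i * labelledDirection δ δ' (l p) p i ≤ -(δ * |f i|) := fun i hi => by
        have hij : i ≠ j := by simpa using hi
        rw [labelledDirection_mul hf (hall i) (by simp [hps' i hij, hneg i]), mul_comm δ]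
        refine neg_le_neg (mul_le_mul_of_nonneg_left ?_ (abs_nonneg _))
        have hn : (1 : ℝ) ≤ n := by exact_mod_cast i.pos
        split_ifs with h1 h2
        · nlinarith
        · simpa [hpj] using h2 j hij.symm
        · exact le_rfl
      have hj' : f j * labelledDirection δ δ' (l p) p j = δ' * |f j| := by
        rw [labelledDirection, if_neg hlj.symm, if_pos hps', hpj]
        nth_rewrite 1 [hfn j]
        simp [mul_comm]
      have h1 := Finset.sum_le_sum hterm
      rw [dotProduct, ← Finset.add_sum_erase _ _ (Finset.mem_univ j), hj'] at hcon
      rw [Finset.sum_neg_distrib, ← Finset.mul_sum] at h1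
      set s := ∑ i ∈ Finset.univ.erase j, |f i| with hs
      have hs0 : 0 ≤ s := Finset.sum_nonneg fun i _ => abs_nonneg _
      have hsi : ∀ i, i ≠ j → |f i| ≤ s := fun i hi =>
        Finset.single_le_sum (f := fun i => |f i|) (fun i _ => abs_nonneg _)
          (Finset.mem_erase.2 ⟨hi, Finset.mem_univ _⟩)
      by_cases hlt : ∃ i, |x j| < |x i|
      · obtain ⟨i, hi⟩ := hlt
        have hij : i ≠ j := by rintro rfl; exact lt_irrefl _ hi
        have h2 := (hf.abs_le_abs hi).trans (hsi i hij)
        have h3 : |f j| ≤ 0 := by nlinarith [abs_nonneg (f j)]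
        have h4 : s ≤ 0 := by nlinarith [abs_nonneg (f j)]
        refine hf0 f hf fun k _ => abs_nonpos_iff.1 ?_
        by_cases hk : k = j
        · rw [hk]; exact h3
        · exact (hsi k hk).trans h4
      · push Not at hlt
        have hx1 : ∀ i, |x i| ≤ 1 - ρ := fun i => (hlt i).trans ((hj i₀).trans hi₀)
        have h2 : 1 ≤ (1 - ρ) * (|f j| + s) := by
          rw [hs, Finset.add_sum_erase _ (fun i => |f i|) (Finset.mem_univ j), Finset.mul_sum]
          calc (1 : ℝ) = ∑ i, f i * x i := hf.1.symm
            _ ≤ ∑ i, (1 - ρ) * |f i| := Finset.sum_le_sum fun i _ => by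
              rw [hf.mul_eq_abs_mul_abs, mul_comm]
              exact mul_le_mul_of_nonneg_right (hx1 i) (abs_nonneg _)
        have h3 : |f j| ≤ 1 := by simpa using hf.2.1 j
        have h4 : 0 ≤ 1 - ρ := (abs_nonneg _).trans (hx1 j)
        have h5 : 0 < ρ := by
          by_contra! hc
          nlinarith
        have h6 : ρ ≤ s := by nlinarith
        nlinarith
    · refine ⟨fun i => decide (x i < 0), fun hc => hneg fun i => ?_, fun f hf => ?_⟩
      · simpa using congrFun hc i
      · exact hfull f hf _ _ fun i => ⟨hall i, rfl⟩
  · push Not at hall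
    obtain ⟨i₁, hi₁⟩ := hall
    let S : Finset (Fin n) := Finset.univ.filter fun i => x i ≠ 0
    have hmem : ∀ i, i ∈ S ↔ x i ≠ 0 := fun i => by simp [S]
    rcases S.eq_empty_or_nonempty with he | hSn
    · refine ⟨fun _ => false, fun h => by simpa using congrFun h i₁, fun f hf => ?_⟩
      refine absurd (fun i hi => ?_) (hf0 f hf)
      simpa [he] using (hmem i).2 hi
    · obtain ⟨p, hp, hps, hpl⟩ := hl S (fun i => decide (x i < 0)) hSn
        (fun h => (hmem i₁).1 (h ▸ Finset.mem_univ _) hi₁)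
      refine ⟨p, hp, fun f hf => ?_⟩
      by_contra! hcon
      have hm : x (l p) ≠ 0 := (hmem _).1 hpl
      have hterm : ∀ i ∈ S, f i * labelledDirection δ δ' (l p) p i ≤ -(δ' * |f i|) := fun i hi => by
        rw [labelledDirection_mul hf ((hmem i).1 hi) (hps i hi), mul_comm δ']
        exact neg_le_neg (mul_le_mul_of_nonneg_left (hmag p _ i) (abs_nonneg _))
      have hm' : f (l p) * labelledDirection δ δ' (l p) p (l p) = -|f (l p)| := by
        rw [labelledDirection_mul hf hm (hps _ hpl)]
        simp
      have hout : ∀ i, i ∉ S → f i * labelledDirection δ δ' (l p) p i ≤ δ * |f (l p)| := by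
        intro i hi
        have hxi : x i = 0 := by simpa using mt (hmem i).2 hi
        have him : i ≠ l p := by rintro h; exact hi (h ▸ hpl)
        have h1 : |f i| ≤ |f (l p)| := hf.abs_le_abs (by rw [hxi, abs_zero]; exact abs_pos.2 hm)
        have h2 : |labelledDirection δ δ' (l p) p i| ≤ δ := by
          rw [labelledDirection, if_neg him, abs_mul]
          have : |(if p i = true then (1 : ℝ) else -1)| = 1 := by split_ifs <;> simp
          rw [this, one_mul]
          split_ifs
          · rw [abs_of_pos hδ']; exact hδδ'.le
          · rw [abs_of_pos hδ0]
        calc _ ≤ |f i * labelledDirection δ δ' (l p) p i| := le_abs_self _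
          _ = |labelledDirection δ δ' (l p) p i| * |f i| := by rw [abs_mul, mul_comm]
          _ ≤ δ * |f (l p)| := mul_le_mul h2 h1 (abs_nonneg _) hδ0.le
      have hfm : |f (l p)| ≤ 0 := by
        have h1 : ∀ i ∈ Finset.univ.erase (l p),
            f i * labelledDirection δ δ' (l p) p i ≤ δ * |f (l p)| := fun i _ => by
          by_cases hi : i ∈ S
          · refine (hterm i hi).trans ?_
            have h1 := mul_nonneg hδ'.le (abs_nonneg (f i))
            have h2 := mul_nonneg hδ0.le (abs_nonneg (f (l p)))
            linarith
          · exact hout i hi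
        have h2 := Finset.sum_le_sum h1
        rw [dotProduct, ← Finset.add_sum_erase _ _ (Finset.mem_univ (l p)), hm'] at hcon
        rw [Finset.sum_const, Finset.card_erase_of_mem (Finset.mem_univ _), Finset.card_fin,
          nsmul_eq_mul, Nat.cast_sub (by omega), Nat.cast_one] at h2
        have h3 := abs_nonneg (f (l p))
        nlinarith [mul_nonneg hδ0.le h3, mul_le_mul_of_nonneg_right hδ h3]
      have hle : ∀ i ∈ Finset.univ, f i * labelledDirection δ δ' (l p) p i ≤ 0 := fun i _ => by
        by_cases hi : i ∈ S
        · refine (hterm i hi).trans ?_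
          have h1 := mul_nonneg hδ'.le (abs_nonneg (f i))
          linarith
        · refine (hout i hi).trans ?_
          nlinarith
      refine hf0 f hf fun i hi => ?_
      have h1 := (Finset.sum_eq_zero_iff_of_nonpos hle).1 (le_antisymm (Finset.sum_nonpos hle) hcon)
        i (Finset.mem_univ i)
      have h2 := hterm i ((hmem i).2 hi)
      rw [h1] at h2
      refine abs_nonpos_iff.1 ?_
      nlinarith

theorem exists_direction_of_nearlyNormal {n : ℕ} (hn : 3 ≤ n) {ρ : ℝ} (hρ : 0 < ρ) (hρ1 : ρ ≤ 1) :
    ∃ η : ℝ, 0 < η ∧ η ≤ 1 ∧ ∃ dir : (Fin n → Bool) → Fin n → ℝ, ∀ x : Fin n → ℝ,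
      (∀ i, |x i| ≤ 1) → (∃ i, |x i| ≤ 1 - ρ) →
      ∃ p, p ≠ (fun _ => true) ∧ ∀ f, NearlyNormal η x f → f ⬝ᵥ dir p < 0 := by
  obtain ⟨l, hl⟩ := exists_labelling hn
  have hn0 : (0 : ℝ) < n := by exact_mod_cast (by omega : 0 < n)
  set δ : ℝ := 1 / (2 * n) with hδ
  have hδ0 : 0 < δ := by positivity
  set dir : (Fin n → Bool) → Fin n → ℝ := fun p => labelledDirection δ (δ * ρ / 2) (l p) p
  by_contra! hcon
  let Z : ℕ → Set ((Fin n → ℝ) × ((Fin n → Bool) → Fin n → ℝ)) := fun k =>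
    {z | (∀ i, |z.1 i| ≤ 1) ∧ (∃ i, |z.1 i| ≤ 1 - ρ) ∧ ∀ p, p ≠ (fun _ => true) →
      NearlyNormal (1 / ((k : ℝ) + 1)) z.1 (z.2 p) ∧ 0 ≤ z.2 p ⬝ᵥ dir p} ∩
    {z | ∀ p i, |z.2 p i| ≤ 2}
  have hk : ∀ k : ℕ, 0 < 1 / ((k : ℝ) + 1) ∧ 1 / ((k : ℝ) + 1) ≤ 1 := fun k =>
    ⟨by positivity, by rw [div_le_one (by positivity)]; linarith [(Nat.cast_nonneg k : (0 : ℝ) ≤ k)]⟩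
  have hanti : ∀ k, Z (k + 1) ⊆ Z k := by
    rintro k z ⟨⟨h1, h2, h3⟩, h4⟩
    have hle : 1 / (((k + 1 : ℕ) : ℝ) + 1) ≤ 1 / ((k : ℝ) + 1) := by
      apply one_div_le_one_div_of_le <;> push_cast <;> linarith [(Nat.cast_nonneg k : (0 : ℝ) ≤ k)]
    refine ⟨⟨h1, h2, fun p hp => ⟨⟨(h3 p hp).1.1, fun i => ((h3 p hp).1.2.1 i).trans ?_,
      fun σ => ((h3 p hp).1.2.2 σ).trans ?_⟩, (h3 p hp).2⟩⟩, h4⟩ <;> linarith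
  have hne : ∀ k, (Z k).Nonempty := by
    intro k
    obtain ⟨x, hx1, hx2, hx3⟩ := hcon _ (hk k).1 (hk k).2 dir
    choose! F hF1 hF2 using hx3
    refine ⟨(x, fun p => if p = (fun _ => true) then 0 else F p), ⟨hx1, hx2, fun p hp => ?_⟩,
      fun p i => ?_⟩
    · simp only [if_neg hp]
      exact ⟨hF1 p hp, hF2 p hp⟩
    · by_cases hp : p = fun _ => true
      · simp [hp]
      · simp only [if_neg hp]
        exact ((hF1 p hp).2.1 i).trans (by linarith [(hk k).2])
  have hcl : ∀ k, IsClosed (Z k) := by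
    intro k
    have : Z k = (⋂ i, {z | |z.1 i| ≤ 1}) ∩ (⋃ i, {z | |z.1 i| ≤ 1 - ρ}) ∩
        (⋂ p, ⋂ (_ : p ≠ fun _ => true), ({z | z.2 p ⬝ᵥ z.1 = 1} ∩
          (⋂ i, {z | |z.2 p i| ≤ 1 + 1 / ((k : ℝ) + 1)}) ∩
          (⋂ σ : Equiv.Perm (Fin n),
            {z | ∑ i, |z.2 p i| * |z.1 (σ i)| ≤ 1 + 1 / ((k : ℝ) + 1)}) ∩
          {z | 0 ≤ z.2 p ⬝ᵥ dir p})) ∩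
        ⋂ p, ⋂ i, {z | |z.2 p i| ≤ 2} := by
      ext z
      simp [Z, NearlyNormal, and_assoc]
    rw [this]
    simp only [dotProduct]
    refine ((IsClosed.inter (isClosed_iInter fun i => ?_) (isClosed_iUnion_of_finite fun i => ?_)).inter
      (isClosed_iInter fun p => isClosed_iInter fun hp => ((IsClosed.inter ?_
        (isClosed_iInter fun i => ?_)).inter (isClosed_iInter fun σ => ?_)).inter ?_)).inter
      (isClosed_iInter fun p => isClosed_iInter fun i => ?_)
    · exact isClosed_le (by fun_prop) (by fun_prop)
    · exact isClosed_le (by fun_prop) (by fun_prop)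
    · exact isClosed_eq (by fun_prop) (by fun_prop)
    · exact isClosed_le (by fun_prop) (by fun_prop)
    · exact isClosed_le (by fun_prop) (by fun_prop)
    · exact isClosed_le (by fun_prop) (by fun_prop)
    · exact isClosed_le (by fun_prop) (by fun_prop)
  have hcpt : IsCompact (Z 0) := by
    refine (isCompact_closedBall (0 : (Fin n → ℝ) × ((Fin n → Bool) → Fin n → ℝ)) 2).of_isClosed_subset
      (hcl 0) fun z hz => ?_
    rw [mem_closedBall_zero_iff, Prod.norm_def, max_le_iff, pi_norm_le_iff_of_nonneg zero_le_two,
      pi_norm_le_iff_of_nonneg zero_le_two]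
    refine ⟨fun i => (hz.1.1 i).trans one_le_two, fun p => ?_⟩
    rw [pi_norm_le_iff_of_nonneg zero_le_two]
    exact hz.2 p
  obtain ⟨z, hz⟩ := IsCompact.nonempty_iInter_of_sequence_nonempty_isCompact_isClosed Z hanti hne
    hcpt hcl
  rw [Set.mem_iInter] at hz
  have hlim : ∀ a : ℝ, (∀ k : ℕ, a ≤ 1 + 1 / ((k : ℝ) + 1)) → a ≤ 1 + 0 := fun a ha =>
    ge_of_tendsto' (tendsto_const_nhds.add tendsto_one_div_add_atTop_nhds_zero_nat) ha
  obtain ⟨p, hp, hpf⟩ := exists_direction_of_nearlyNormal_zero (by omega) hl (δ := δ)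
    (δ' := δ * ρ / 2) (ρ := ρ) (by positivity) (by nlinarith) (by rw [hδ]; field_simp; rfl)
    (by nlinarith [mul_pos hδ0 hρ]) (hz 0).1.2.1
  refine absurd (hpf (z.2 p) ⟨((hz 0).1.2.2 p hp).1.1, fun i => ?_, fun σ => ?_⟩)
    (not_lt.2 ((hz 0).1.2.2 p hp).2)
  · exact hlim _ fun k => ((hz k).1.2.2 p hp).1.2.1 i
  · exact hlim _ fun k => ((hz k).1.2.2 p hp).1.2.2 σ

/-- `K` is a convex body squeezed between the cubes `(1 - r) • [-1, 1]ⁿ` and `[-1, 1]ⁿ`. -/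
structure NearCube {n : ℕ} (K : Set (Fin n → ℝ)) (r : ℝ) : Prop where
  convex : Convex ℝ K
  isCompact : IsCompact K
  abs_le_one : ∀ x ∈ K, ∀ i, |x i| ≤ 1
  mem_of_abs_le : ∀ x : Fin n → ℝ, (∀ i, |x i| ≤ 1 - r) → x ∈ K

/-- The hyperplane `f = 1` supports `K` at `x`. -/
structure SupportsAt {n : ℕ} (K : Set (Fin n → ℝ)) (x f : Fin n → ℝ) : Prop where
  mem : x ∈ K
  dotProduct_eq : f ⬝ᵥ x = 1
  dotProduct_le : ∀ y ∈ K, f ⬝ᵥ y ≤ 1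

section NearCube

variable {n : ℕ} {K : Set (Fin n → ℝ)} {r : ℝ} {x f : Fin n → ℝ}

theorem NearCube.sum_abs_le (hK : NearCube K r) (hr0 : 0 ≤ r) (hr : r ≤ 1 / 2)
    (hf : SupportsAt K x f) : ∑ i, |f i| ≤ 1 + 2 * r := by
  have h1 : (1 - r) * ∑ i, |f i| ≤ 1 := by
    refine le_trans (le_of_eq ?_) (hf.dotProduct_le
      (fun i => (1 - r) * if 0 ≤ f i then 1 else -1) (hK.mem_of_abs_le _ fun i => ?_))
    · rw [dotProduct, Finset.mul_sum]
      refine Finset.sum_congr rfl fun i _ => ?_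
      split_ifs with h
      · rw [abs_of_nonneg h]; ring
      · rw [abs_of_neg (not_le.1 h)]; ring
    · rw [abs_mul, abs_of_nonneg (by linarith)]
      split_ifs <;> simp
  have h2 : 0 ≤ ∑ i, |f i| := Finset.sum_nonneg fun i _ => abs_nonneg _
  nlinarith

theorem NearCube.mul_le_abs (hK : NearCube K r) (hf : SupportsAt K x f) (i : Fin n) :
    f i * x i ≤ |f i| := by
  calc f i * x i ≤ |f i * x i| := le_abs_self _
    _ = |f i| * |x i| := abs_mul _ _
    _ ≤ |f i| * 1 := mul_le_mul_of_nonneg_left (hK.abs_le_one x hf.mem i) (abs_nonneg _)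
    _ = |f i| := mul_one _

theorem NearCube.one_le_sum_abs (hK : NearCube K r) (hf : SupportsAt K x f) :
    1 ≤ ∑ i, |f i| := by
  rw [← hf.dotProduct_eq]
  exact Finset.sum_le_sum fun i _ => hK.mul_le_abs hf i

theorem NearCube.sum_abs_sub_le (hK : NearCube K r) (hr0 : 0 ≤ r) (hr : r ≤ 1 / 2)
    (hf : SupportsAt K x f) : ∑ i, (|f i| - f i * x i) ≤ 2 * r := by
  have h1 := hK.sum_abs_le hr0 hr hf
  have h2 := hf.dotProduct_eq
  rw [dotProduct] at h2
  rw [Finset.sum_sub_distrib]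
  linarith

theorem NearCube.abs_sub_le (hK : NearCube K r) (hr0 : 0 ≤ r) (hr : r ≤ 1 / 2)
    (hf : SupportsAt K x f) (i : Fin n) : |f i| - f i * x i ≤ 2 * r :=
  (Finset.single_le_sum (f := fun i => |f i| - f i * x i)
    (fun i _ => sub_nonneg.2 (hK.mul_le_abs hf i)) (Finset.mem_univ i)).trans
    (hK.sum_abs_sub_le hr0 hr hf)

theorem NearCube.le_of_neg (hK : NearCube K r) (hr0 : 0 ≤ r) (hr : r ≤ 1 / 2)
    (hf : SupportsAt K x f) {i : Fin n} (hx : x i ≤ 0) : f i ≤ 2 * r := by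
  have h := hK.abs_sub_le hr0 hr hf i
  by_contra! hc
  have h1 : 0 < f i := by linarith
  rw [abs_of_pos h1] at h
  nlinarith

/-- A direction opposite in sign to all the large coordinates of `x` illuminates `x`. -/
theorem NearCube.dotProduct_neg (hK : NearCube K r) (hr0 : 0 ≤ r) {ρ : ℝ} (hρ : 4 * r < ρ)
    (hρ1 : ρ ≤ 1) (hf : SupportsAt K x f) {d : Fin n → ℝ} (hd : ∀ i, |d i| ≤ 1)
    (hd1 : ∀ i, 1 - ρ < x i → d i = -1) (hd2 : ∀ i, x i < -(1 - ρ) → d i = 1) :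
    f ⬝ᵥ d < 0 := by
  have hρ0 : 0 < ρ := by linarith
  have hterm : ∀ i ∈ Finset.univ, ρ * (f i * d i) ≤ -(ρ * |f i|) + 2 * (|f i| - f i * x i) := by
    intro i _
    have hx := abs_le.1 (hK.abs_le_one x hf.mem i)
    by_cases h1 : 1 - ρ < x i
    · rw [hd1 i h1]
      rcases le_or_gt 0 (f i) with h | h
      · rw [abs_of_nonneg h]; nlinarith
      · rw [abs_of_neg h]; nlinarith
    by_cases h2 : x i < -(1 - ρ)
    · rw [hd2 i h2]
      rcases le_or_gt 0 (f i) with h | h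
      · rw [abs_of_nonneg h]; nlinarith
      · rw [abs_of_neg h]; nlinarith
    have hfx : f i * x i ≤ |f i| * (1 - ρ) := by
      refine (le_abs_self _).trans ?_
      rw [abs_mul]
      exact mul_le_mul_of_nonneg_left (abs_le.2 ⟨by linarith, by linarith⟩) (abs_nonneg _)
    have hfd : f i * d i ≤ |f i| * 1 := by
      refine (le_abs_self _).trans ?_
      rw [abs_mul]
      exact mul_le_mul_of_nonneg_left (hd i) (abs_nonneg _)
    nlinarith
  have h1 := Finset.sum_le_sum hterm
  rw [← Finset.mul_sum, Finset.sum_add_distrib, Finset.sum_neg_distrib, ← Finset.mul_sum,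
    ← Finset.mul_sum] at h1
  have h2 := hK.sum_abs_sub_le hr0 (by linarith) hf
  have h3 := hK.one_le_sum_abs hf
  rw [dotProduct]
  nlinarith

theorem NearCube.exists_supportsAt (hK : NearCube K r) (hr : r < 1) (hx : x ∈ frontier K)
    {d : Fin n → ℝ} (h : ¬ ∃ ε : ℝ, 0 < ε ∧ x + ε • d ∈ interior K) :
    ∃ f, SupportsAt K x f ∧ 0 ≤ f ⬝ᵥ d := by
  by_contra! hcon
  refine h (illuminates_of_forall_normal hK.convex hK.isCompact
    (zero_mem_interior_of_cube_subset (by linarith : 0 < 1 - r) hK.mem_of_abs_le) hx fun f h1 h2 => ?_)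
  exact hcon f ⟨hK.isCompact.isClosed.frontier_subset hx, h1, h2⟩

theorem NearCube.illuminates (hK : NearCube K r) (hr : r < 1) (hx : x ∈ frontier K)
    {d : Fin n → ℝ} (h : ∀ f, SupportsAt K x f → f ⬝ᵥ d < 0) :
    ∃ ε : ℝ, 0 < ε ∧ x + ε • d ∈ interior K := by
  by_contra hc
  obtain ⟨f, hf, hfd⟩ := hK.exists_supportsAt hr hx hc
  exact not_lt.2 hfd (h f hf)

theorem illuminable_of_finset {dir : Finset (Fin n) → Fin n → ℝ}
    (h : ∀ x ∈ frontier K, ∃ s : Finset (Fin n), s.Nonempty ∧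
      ∃ ε : ℝ, 0 < ε ∧ x + ε • dir s ∈ interior K) : Illuminable K (2 ^ n - 1) := by
  classical
  refine ⟨(Finset.univ.erase ∅).image dir, Finset.card_image_le.trans ?_, fun x hx => ?_⟩
  · rw [Finset.card_erase_of_mem (Finset.mem_univ _), Finset.card_univ, Fintype.card_finset,
      Fintype.card_fin]
  · obtain ⟨s, hs, h⟩ := h x hx
    exact ⟨dir s, Finset.mem_image_of_mem _ (by simpa using hs.ne_empty), h⟩

theorem sum_erase_mul_le {a y : Fin n → ℝ} {ρ : ℝ} (hr0 : 0 ≤ r) (hρ : 0 ≤ ρ) {j : Fin n}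
    (ha : ∀ i, i ≠ j → -(2 * r) ≤ a i) (hy : ∀ i, i ≠ j → 0 ≤ y i ∧ y i ≤ ρ) :
    -∑ i ∈ Finset.univ.erase j, a i * y i ≤ n * (2 * r * ρ) := by
  rw [← Finset.sum_neg_distrib]
  calc _ ≤ ∑ i ∈ Finset.univ.erase j, 2 * r * ρ := Finset.sum_le_sum fun i hi => by
        have hij := Finset.ne_of_mem_erase hi
        have := ha i hij
        obtain ⟨h1, h2⟩ := hy i hij
        nlinarith [mul_le_mul_of_nonneg_left h2 hr0]
    _ ≤ n * (2 * r * ρ) := by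
        rw [Finset.sum_const, nsmul_eq_mul]
        refine mul_le_mul_of_nonneg_right ?_ (by positivity)
        exact_mod_cast (Finset.card_erase_le).trans (by simp)

/-- A near-cube having a vertex of the cube at distance at least `r`, and almost touching the cube
along all coordinate axes, can be illuminated by `2 ^ n - 1` directions. -/
theorem NearCube.illuminable_of_axes (hK : NearCube K r) (hr0 : 0 < r) {ρ : ℝ} (hρ : 4 * r < ρ)
    (hnρ : n * ρ ≤ 1 / 100) (hρ1 : ρ ≤ 1 / 100)
    (hv : ∀ x ∈ K, ∃ j, -1 + r ≤ x j)
    (hc : ∀ j, (Pi.single j (1 - r / 100) : Fin n → ℝ) ∈ K ∧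
      (Pi.single j (-(1 - r / 100)) : Fin n → ℝ) ∈ K) :
    Illuminable K (2 ^ n - 1) := by
  classical
  have hfj : ∀ x f, SupportsAt K x f → ∀ j, |f j| ≤ 1 + 2 * (r / 100) := by
    intro x f hf j
    have h1 := hf.dotProduct_le _ (hc j).1
    have h2 := hf.dotProduct_le _ (hc j).2
    rw [dotProduct_single] at h1 h2
    have h4 : |f j| * (1 - r / 100) ≤ 1 := by
      rcases abs_cases (f j) with h | h <;> rw [h.1] <;> linarith
    nlinarith [abs_nonneg (f j)]
  let dir : Finset (Fin n) → Fin n → ℝ := fun s i =>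
    if i ∈ s then (if s = {i} then -(r / 8) else -1) else 1
  have hdir : ∀ s i, |dir s i| ≤ 1 := by
    intro s i
    simp only [dir]
    split_ifs
    · rw [abs_neg, abs_of_pos] <;> linarith
    · simp
    · simp
  have hsum : ∀ (f : Fin n → ℝ) j, f ⬝ᵥ dir {j} =
      -(f j * (r / 8)) + ∑ i ∈ Finset.univ.erase j, f i := by
    intro f j
    rw [dotProduct, ← Finset.add_sum_erase _ _ (Finset.mem_univ j)]
    congr 1
    · simp [dir]
    · refine Finset.sum_congr rfl fun i hi => ?_
      simp [dir, Finset.ne_of_mem_erase hi]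
  have hsum' : ∀ (f x : Fin n → ℝ) j, f ⬝ᵥ x = f j * x j - ∑ i ∈ Finset.univ.erase j, f i
      - ∑ i ∈ Finset.univ.erase j, (-f i) * (1 + x i) := by
    intro f x j
    rw [dotProduct, ← Finset.add_sum_erase _ _ (Finset.mem_univ j), sub_sub,
      ← Finset.sum_add_distrib, sub_eq_add_neg, ← Finset.sum_neg_distrib]
    congr 1
    exact Finset.sum_congr rfl fun i hi => by ring
  refine illuminable_of_finset (dir := dir) fun x hx => ?_
  have hxK := hK.isCompact.isClosed.frontier_subset hx
  have hx1 := fun i => abs_le.1 (hK.abs_le_one x hxK i)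
  let s : Finset (Fin n) := Finset.univ.filter fun i => -(1 - ρ) ≤ x i
  have hs : ∀ i, i ∈ s ↔ -(1 - ρ) ≤ x i := fun i => by simp [s]
  have hoff : ∀ j, (∀ i, i ≠ j → i ∉ s) → ∀ f, SupportsAt K x f →
      -∑ i ∈ Finset.univ.erase j, (-f i) * (1 + x i) ≤ r / 50 := by
    intro j hj f hf
    have hj' : ∀ i, i ≠ j → x i < -(1 - ρ) := fun i hi => not_le.1 fun h => hj i hi ((hs i).2 h)
    have := sum_erase_mul_le (r := r) (ρ := ρ) (a := fun i => -f i) (y := fun i => 1 + x i) (j := j)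
      hr0.le (by linarith)
      (fun i hi => neg_le_neg (hK.le_of_neg hr0.le (by linarith) hf (by linarith [hj' i hi])))
      (fun i hi => ⟨by linarith [hx1 i], by linarith [hj' i hi]⟩)
    nlinarith
  rcases s.eq_empty_or_nonempty with he | hne
  · by_contra! hcon
    obtain ⟨j, hj⟩ := hv x hxK
    have hxj : x j < -(1 - ρ) := not_le.1 fun h => by
      have := (hs j).2 h
      simp [he] at this
    obtain ⟨f, hf, hfd⟩ := hK.exists_supportsAt (by linarith) hx (d := dir {j}) (by
      push Not
      exact hcon {j} (Finset.singleton_nonempty j))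
    have h1 := hoff j (fun i _ => by simp [he]) f hf
    have h2 := hf.dotProduct_eq
    rw [hsum'  f x j] at h2
    rw [hsum] at hfd
    have h3 := neg_le_of_abs_le (hfj x f hf j)
    have h4 : 1 ≤ -f j * (-x j + r / 8) + r / 50 := by linarith
    have h5 : 1 / 2 ≤ -f j := by
      have : 0 < -x j + r / 8 := by linarith
      have h6 : -x j + r / 8 ≤ 3 / 2 := by linarith [hx1 j]
      by_contra! hc
      nlinarith
    nlinarith
  · by_cases hcard : ∃ j, s = {j}
    · obtain ⟨j, hj⟩ := hcard
      refine ⟨s, hne, hK.illuminates (by linarith) hx fun f hf => ?_⟩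
      have hoffj : ∀ i, i ≠ j → i ∉ s := fun i hi => by simpa [hj] using hi
      by_cases hxj : 1 - ρ < x j
      · by_contra! hfd
        have h1 := hoff j hoffj f hf
        have h2 := hf.dotProduct_eq
        rw [hsum' f x j] at h2
        rw [hj, hsum] at hfd
        have h3 := le_of_abs_le (hfj x f hf j)
        have h4 : 1 ≤ f j * (x j - r / 8) + r / 50 := by linarith
        have h5 : 1 / 2 ≤ f j := by
          have : 0 < x j - r / 8 := by linarith
          have h6 : x j - r / 8 ≤ 1 := by linarith [hx1 j]
          by_contra! hc
          nlinarith
        nlinarith [hx1 j]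
      · refine hK.dotProduct_neg hr0.le hρ (by linarith) hf (hdir s) (fun i hi => ?_) fun i hi => ?_
        · have : i ∈ s := (hs i).2 (by linarith)
          rw [hj, Finset.mem_singleton] at this
          exact absurd (this ▸ hi) hxj
        · have : i ∉ s := fun h => by linarith [(hs i).1 h]
          simp [dir, this]
    · refine ⟨s, hne, hK.illuminates (by linarith) hx fun f hf => ?_⟩
      refine hK.dotProduct_neg hr0.le hρ (by linarith) hf (hdir s) (fun i hi => ?_) fun i hi => ?_
      · have : i ∈ s := (hs i).2 (by linarith)
        have h2 : s ≠ {i} := fun h => hcard ⟨i, h⟩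
        simp [dir, this, h2]
      · have : i ∉ s := fun h => by linarith [(hs i).1 h]
        simp [dir, this]

end NearCube

section NearCubeChord

variable {n : ℕ} {K : Set (Fin n → ℝ)} {r : ℝ} {x f : Fin n → ℝ}

theorem NearCube.dotProduct_neg_of_chord (hK : NearCube K r) (hr0 : 0 < r) {η : ℝ} (hη0 : 0 < η)
    (hη : η * (4000 * (n + 1) ^ 2) ≤ 1) (hr : 16 * r ≤ η) (hf : SupportsAt K x f) {j : Fin n}
    {e t₀ t θ G : ℝ} (he : e = 1 ∨ e = -1) (hxi : ∀ i, i ≠ j → x i < -(1 - η / 2))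
    (hxj : 1 - η / 2 < e * x j) (h0 : (Pi.single j (e * t₀) : Fin n → ℝ) ∈ K)
    (ht : ∀ p ∈ K, (∀ i, i ≠ j → p i = -(1 - η)) → e * p j ≤ t)
    (hθ : e * θ * (1 - η) = t₀ - t - G) (hG : r / 400 ≤ G) (hθ' : |θ| ≤ 2 * r) :
    f ⬝ᵥ Function.update 1 j θ < 0 := by
  by_contra! hfd
  have hn : (0 : ℝ) ≤ n := Nat.cast_nonneg n
  have hηn : 0 ≤ η * n := mul_nonneg hη0.le hn
  have hηnn : 0 ≤ η * n * n := mul_nonneg hηn hn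
  have hη1 : η ≤ 1 / 4000 := by linarith
  have hee : e * e = 1 := by rcases he with rfl | rfl <;> norm_num
  have hx1 := fun i => abs_le.1 (hK.abs_le_one x hf.mem i)
  have hfi : ∀ i, i ≠ j → f i ≤ 2 * r := fun i hi =>
    hK.le_of_neg hr0.le (by linarith) hf (by linarith [hxi i hi])
  set S := ∑ i ∈ Finset.univ.erase j, f i with hS
  set Y := ∑ i ∈ Finset.univ.erase j, (-f i) * (1 + x i) with hY
  have hfx : f j * x j - S - Y = 1 := by
    rw [← hf.dotProduct_eq, dotProduct, ← Finset.add_sum_erase _ _ (Finset.mem_univ j), sub_sub,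
      hS, hY, ← Finset.sum_add_distrib, sub_eq_add_neg, ← Finset.sum_neg_distrib]
    congr 1
    exact Finset.sum_congr rfl fun i hi => by ring
  have hfd' : 0 ≤ f j * θ + S := by
    refine hfd.trans (le_of_eq ?_)
    rw [dotProduct, ← Finset.add_sum_erase _ _ (Finset.mem_univ j)]
    congr 1
    · simp
    · exact Finset.sum_congr rfl fun i hi => by
        simp [Function.update_of_ne (Finset.ne_of_mem_erase hi)]
  have hY0 : -Y ≤ r / 4000 := by
    have := sum_erase_mul_le (r := r) (ρ := η / 2) (a := fun i => -f i) (y := fun i => 1 + x i)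
      (j := j) hr0.le (by linarith) (fun i hi => neg_le_neg (hfi i hi))
      (fun i hi => ⟨by linarith [hx1 i], by linarith [hxi i hi]⟩)
    have h1 : n * η ≤ 1 / 4000 := by linarith
    refine this.trans ?_
    nlinarith
  have hfj : |f j| ≤ 2 := by
    have h1 := hK.sum_abs_le hr0.le (by linarith) hf
    have h2 := Finset.single_le_sum (f := fun i => |f i|) (fun i _ => abs_nonneg _)
      (Finset.mem_univ j)
    linarith
  have hS0 : -S ≤ 4 * r := by
    have h1 : f j * θ ≤ 2 * (2 * r) := by
      refine (le_abs_self _).trans ?_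
      rw [abs_mul]
      exact mul_le_mul hfj hθ' (abs_nonneg _) zero_le_two
    linarith
  set A := e * f j with hA
  set X := e * x j with hX
  have hAX : f j * x j = A * X := by
    rw [hA, hX, show e * f j * (e * x j) = e * e * (f j * x j) by ring, hee, one_mul]
  have hX1 : X ≤ 1 := by
    rcases he with h | h <;> rw [hX, h] <;> linarith [hx1 j]
  have hA0 : 1 / 2 ≤ A := by
    have : 1 / 2 ≤ A * X := by linarith
    by_contra! hc
    nlinarith
  have hA2 : A ≤ 2 := by
    have := abs_le.1 hfj
    rcases he with h | h <;> rw [hA, h] <;> linarith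
  have hfi' : ∀ i, i ≠ j → |f i| ≤ (2 * n + 4) * r := by
    intro i hi
    rw [abs_le]
    refine ⟨?_, (hfi i hi).trans (by nlinarith)⟩
    have h1 : S ≤ f i + n * (2 * r) := by
      rw [hS, ← Finset.add_sum_erase _ _ (Finset.mem_erase.2 ⟨hi, Finset.mem_univ i⟩)]
      refine add_le_add le_rfl ?_
      calc _ ≤ ∑ k ∈ (Finset.univ.erase j).erase i, 2 * r := Finset.sum_le_sum fun k hk =>
            hfi k (Finset.ne_of_mem_erase (Finset.mem_of_mem_erase hk))
        _ ≤ n * (2 * r) := by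
            rw [Finset.sum_const, nsmul_eq_mul]
            refine mul_le_mul_of_nonneg_right ?_ (by positivity)
            exact_mod_cast ((Finset.card_erase_le).trans Finset.card_erase_le).trans (by simp)
    nlinarith
  have hE : -(S * η) - Y ≤ n * ((2 * n + 4) * r * η) := by
    have : -(S * η) - Y = ∑ i ∈ Finset.univ.erase j, (-f i) * (η - (1 + x i)) := by
      rw [hS, hY, Finset.sum_mul, ← Finset.sum_neg_distrib, ← Finset.sum_sub_distrib]
      exact Finset.sum_congr rfl fun i hi => by ring
    rw [this]
    calc _ ≤ ∑ i ∈ Finset.univ.erase j, (2 * n + 4) * r * η := Finset.sum_le_sum fun i hi => by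
          have hij := Finset.ne_of_mem_erase hi
          refine (le_abs_self _).trans ?_
          rw [abs_mul, abs_neg]
          refine mul_le_mul (hfi' i hij) ?_ (abs_nonneg _) (by positivity)
          rw [abs_le]
          constructor <;> linarith [hx1 i, hxi i hij]
      _ ≤ n * ((2 * n + 4) * r * η) := by
          rw [Finset.sum_const, nsmul_eq_mul]
          refine mul_le_mul_of_nonneg_right ?_ (by positivity)
          exact_mod_cast (Finset.card_erase_le).trans (by simp)
  have ht0 : A * t₀ ≤ 1 := by
    have := hf.dotProduct_le _ h0
    rw [dotProduct_single] at this
    rw [hA]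
    linarith
  have htX : (1 - 2 * η) * X + 2 * η * (1 - r) ≤ t := by
    let m : Fin n → ℝ := fun i =>
      if i = j then e * (1 - r) else -(1 / 2) - (1 - 2 * η) * ((1 + x i) / (2 * η))
    have hm : m ∈ K := by
      refine hK.mem_of_abs_le _ fun i => ?_
      by_cases hi : i = j
      · simp only [m, hi, if_true]
        rcases he with h | h <;> rw [h]
        · rw [one_mul, abs_of_nonneg]; linarith
        · rw [neg_one_mul, abs_neg, abs_of_nonneg]; linarith
      · simp only [m, hi, if_false]
        have h1 : (1 + x i) / (2 * η) ≤ 1 / 4 := by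
          rw [div_le_iff₀ (by positivity)]
          linarith [hxi i hi]
        have h2 : 0 ≤ (1 + x i) / (2 * η) := div_nonneg (by linarith [hx1 i]) (by positivity)
        rw [abs_le]
        constructor <;> nlinarith
    have hmix := hK.convex hf.mem hm (by linarith : 0 ≤ 1 - 2 * η) (by linarith : 0 ≤ 2 * η)
      (by ring)
    have := ht _ hmix fun i hi => by
      simp only [Pi.add_apply, Pi.smul_apply, smul_eq_mul, m, hi, if_false]
      field_simp
      ring
    simp only [Pi.add_apply, Pi.smul_apply, smul_eq_mul, m, if_true] at this
    calc _ = (1 - 2 * η) * (e * x j) + 2 * η * ((e * e) * (1 - r)) := by rw [hee, hX]; ring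
      _ ≤ t := by linarith
  have h1 : 0 ≤ A * (t₀ - t - G) + (1 - η) * S := by
    have h2 : (1 - η) * (f j * θ + S) = A * (t₀ - t - G) + (1 - η) * S := by
      rw [← hθ, hA, show e * f j * (e * θ * (1 - η)) = e * e * (f j * θ * (1 - η)) by ring, hee]
      ring
    rw [← h2]
    exact mul_nonneg (by linarith) hfd'
  have h3 : A * (X - t) ≤ A * (2 * η * r) := by
    refine mul_le_mul_of_nonneg_left ?_ (by linarith)
    nlinarith
  have h4 : A * (G - 2 * η * r) ≤ n * ((2 * n + 4) * r * η) := by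
    rw [hAX] at hfx
    linarith
  have h5 : r / 500 ≤ G - 2 * η * r := by
    have := mul_le_mul_of_nonneg_right hη1 hr0.le
    linarith
  have h6 : r / 1000 ≤ A * (G - 2 * η * r) := by
    calc r / 1000 = 1 / 2 * (r / 500) := by ring
      _ ≤ A * (G - 2 * η * r) := mul_le_mul hA0 h5 (by positivity) (by linarith)
  have h7 : n * ((2 * n + 4) * r * η) ≤ r / 2000 := by
    have : (n * (2 * n + 4)) * η ≤ 1 / 2000 := by linarith
    have := mul_le_mul_of_nonneg_right this hr0.le
    linarith
  linarith

/-- If the chords of a near-cube in the `j`-th direction through the origin and through a point near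
a vertex of the cube differ in length, then the body is illuminated by `2 ^ n - 1` directions. -/
theorem NearCube.illuminable_of_chord (hK : NearCube K r) (hr0 : 0 < r) {η : ℝ} (hη0 : 0 < η)
    (hη : η * (4000 * (n + 1) ^ 2) ≤ 1) (hr : 16 * r ≤ η) {j : Fin n} {τ₀ β₀ τ β : ℝ}
    (hτ₀ : (Pi.single j τ₀ : Fin n → ℝ) ∈ K) (hβ₀ : (Pi.single j β₀ : Fin n → ℝ) ∈ K)
    (hτ₀r : 1 - r ≤ τ₀) (hβ₀r : β₀ ≤ -(1 - r)) (hτ1 : τ ≤ 1) (hβ1 : -1 ≤ β)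
    (h : ∀ p ∈ K, (∀ i, i ≠ j → p i = -(1 - η)) → β ≤ p j ∧ p j ≤ τ)
    (hlen : (τ - β) + r / 200 ≤ τ₀ - β₀) : Illuminable K (2 ^ n - 1) := by
  classical
  have hn : (0 : ℝ) ≤ n := Nat.cast_nonneg n
  have hηn : 0 ≤ η * n := mul_nonneg hη0.le hn
  have hηnn : 0 ≤ η * n * n := mul_nonneg hηn hn
  have hη1 : η ≤ 1 / 4000 := by linarith
  have hτβ : β ≤ -(1 - r) ∧ 1 - r ≤ τ := by
    have key : ∀ t : ℝ, |t| ≤ 1 - r → β ≤ t ∧ t ≤ τ := fun t ht => by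
      have := h (fun i => if i = j then t else -(1 - η)) (hK.mem_of_abs_le _ fun i => ?_)
        (fun i hi => by simp [hi])
      · simpa using this
      · split_ifs
        · exact ht
        · rw [abs_neg, abs_of_nonneg] <;> linarith
    exact ⟨(key (-(1 - r)) (by rw [abs_neg, abs_of_nonneg]; linarith)).1,
      (key (1 - r) (by rw [abs_of_nonneg]; linarith)).2⟩
  have hτ₀1 : τ₀ ≤ 1 := by simpa using (abs_le.1 (hK.abs_le_one _ hτ₀ j)).2
  have hβ₀1 : -1 ≤ β₀ := by simpa using (abs_le.1 (hK.abs_le_one _ hβ₀ j)).1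
  set θ : ℝ := ((τ₀ + β₀) - (τ + β)) / (2 * (1 - η)) with hθ
  have hθη : θ * (1 - η) = ((τ₀ + β₀) - (τ + β)) / 2 := by
    have : 1 - η ≠ 0 := by linarith
    rw [hθ]
    field_simp
  have hθr : |θ| ≤ 2 * r := by
    rw [abs_le]
    constructor <;> nlinarith
  let dir : Finset (Fin n) → Fin n → ℝ := fun s =>
    if s = {j} then Function.update 1 j θ else fun i => if i ∈ s then -1 else 1
  refine illuminable_of_finset (dir := dir) fun x hx => ?_
  have hxK := hK.isCompact.isClosed.frontier_subset hx
  let s : Finset (Fin n) := Finset.univ.filter fun i => -(1 - η / 2) ≤ x i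
  have hs : ∀ i, i ∈ s ↔ -(1 - η / 2) ≤ x i := fun i => by simp [s]
  by_cases hsj : s ⊆ {j}
  · refine ⟨{j}, Finset.singleton_nonempty j, hK.illuminates (by linarith) hx fun f hf => ?_⟩
    have hxi : ∀ i, i ≠ j → x i < -(1 - η / 2) := fun i hi => not_le.1 fun h =>
      hi (by simpa using hsj ((hs i).2 h))
    rw [show dir {j} = Function.update (1 : Fin n → ℝ) j θ by simp [dir]]
    by_cases h1 : 1 - η / 2 < x j
    · exact hK.dotProduct_neg_of_chord hr0 hη0 hη hr hf (e := 1) (t₀ := τ₀) (t := τ) (θ := θ)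
        (G := ((τ₀ - β₀) - (τ - β)) / 2) (Or.inl rfl) hxi (by simpa using h1) (by simpa using hτ₀)
        (fun p hp hpi => by simpa using (h p hp hpi).2) (by rw [one_mul, hθη]; ring) (by linarith)
        hθr
    by_cases h2 : x j < -(1 - η / 2)
    · exact hK.dotProduct_neg_of_chord hr0 hη0 hη hr hf (e := -1) (t₀ := -β₀) (t := -β) (θ := θ)
        (G := ((τ₀ - β₀) - (τ - β)) / 2) (Or.inr rfl) hxi (by linarith) (by simpa using hβ₀)
        (fun p hp hpi => by simpa using (h p hp hpi).1)
        (by rw [neg_one_mul, neg_mul, hθη]; ring) (by linarith) hθr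
    · refine hK.dotProduct_neg hr0.le (ρ := η / 2) (by linarith) (by linarith) hf (fun i => ?_)
        (fun i hi => ?_) (fun i hi => ?_)
      · by_cases hij : i = j
        · rw [hij, Function.update_self]; linarith
        · simp [Function.update_of_ne hij]
      · by_cases hij : i = j
        · exact absurd (hij ▸ hi) h1
        · linarith [hxi i hij]
      · by_cases hij : i = j
        · exact absurd (hij ▸ hi) h2
        · simp [Function.update_of_ne hij]
  · have hs1 : s ≠ {j} := fun h => hsj h.subset
    have hne : s.Nonempty := by
      rw [Finset.nonempty_iff_ne_empty]
      intro h
      exact hsj (by simp [h])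
    refine ⟨s, hne, hK.illuminates (by linarith) hx fun f hf => ?_⟩
    refine hK.dotProduct_neg hr0.le (ρ := η / 2) (by linarith) (by linarith) hf (fun i => ?_)
      (fun i hi => ?_) (fun i hi => ?_)
    · simp only [dir, if_neg hs1]
      split_ifs <;> simp
    · have : i ∈ s := (hs i).2 (by linarith)
      simp [dir, hs1, this]
    · have : i ∉ s := fun h => by linarith [(hs i).1 h]
      simp [dir, hs1, this]

end NearCubeChord

section SignChange

variable {n : ℕ} {K : Set (Fin n → ℝ)} {r : ℝ} {u : Fin n → ℝ}

theorem mul_self_of_sign (hu : ∀ i, u i = 1 ∨ u i = -1) : u * u = 1 := by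
  ext i
  rcases hu i with h | h <;> simp [h]

theorem image_sign_mul (hu : ∀ i, u i = 1 ∨ u i = -1) :
    (fun x => u * x) '' K = {x | u * x ∈ K} := by
  have huu : ∀ x : Fin n → ℝ, u * (u * x) = x := fun x => by
    rw [← mul_assoc, mul_self_of_sign hu, one_mul]
  ext x
  constructor
  · rintro ⟨y, hy, rfl⟩
    simpa [huu] using hy
  · intro hx
    exact ⟨u * x, hx, huu x⟩

theorem Illuminable.of_sign {m : ℕ} (hu : ∀ i, u i = 1 ∨ u i = -1)
    (h : Illuminable {x | u * x ∈ K} m) : Illuminable K m := by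
  have huu : Function.Involutive (LinearMap.mulLeft ℝ u) := fun x => by
    rw [LinearMap.mulLeft_apply, LinearMap.mulLeft_apply, ← mul_assoc, mul_self_of_sign hu, one_mul]
  refine Illuminable.of_image (LinearEquiv.ofInvolutive _ huu).toAffineEquiv ?_
  rw [← image_sign_mul hu] at h
  exact h

theorem abs_sign_mul (hu : ∀ i, u i = 1 ∨ u i = -1) (x : Fin n → ℝ) (i : Fin n) :
    |(u * x) i| = |x i| := by
  rcases hu i with h | h <;> simp [h]

theorem NearCube.sign (hK : NearCube K r) (hu : ∀ i, u i = 1 ∨ u i = -1) :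
    NearCube {x | u * x ∈ K} r where
  convex := hK.convex.linear_preimage (LinearMap.mulLeft ℝ u)
  isCompact := by
    rw [← image_sign_mul hu]
    exact hK.isCompact.image (by fun_prop)
  abs_le_one x hx i := by
    rw [← abs_sign_mul hu]
    exact hK.abs_le_one _ hx i
  mem_of_abs_le x hx := hK.mem_of_abs_le _ fun i => by
    rw [abs_sign_mul hu]
    exact hx i

end SignChange

section Vertices

variable {n : ℕ} {K : Set (Fin n → ℝ)} {r : ℝ}

theorem cube_subset_of_vertices (hK : Convex ℝ K) {s : ℝ}
    (h : ∀ u : Fin n → ℝ, (∀ i, u i = 1 ∨ u i = -1) → s • u ∈ K) {x : Fin n → ℝ}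
    (hx : ∀ i, |x i| ≤ s) : x ∈ K := by
  have h1 : Set.univ.pi (fun _ : Fin n => ({-s, s} : Set ℝ)) ⊆ K := by
    intro y hy
    have hy' : ∀ i, y i = -s ∨ y i = s := fun i => by simpa using hy i (Set.mem_univ i)
    convert h (fun i => if y i = s then 1 else -1) (fun i => by split_ifs <;> simp) using 1
    ext i
    by_cases hi : y i = s
    · simp [hi]
    · simp [(hy' i).resolve_right hi]
  refine convexHull_min h1 hK ?_
  rw [convexHull_pi]
  intro i _
  rw [convexHull_pair, segment_eq_Icc (by linarith [abs_nonneg (x i), hx i])]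
  exact abs_le.1 (hx i)

theorem NearCube.exists_vertex (hK : NearCube K r) (hr : 0 ≤ r) (hr1 : r ≤ 1)
    (hne : K ≠ {y | ∀ i, |y i| ≤ 1}) :
    ∃ (r' : ℝ) (u : Fin n → ℝ), 0 < r' ∧ r' ≤ r ∧ NearCube K r' ∧ (∀ i, u i = 1 ∨ u i = -1) ∧
      ∀ x ∈ K, ∃ j, r' ≤ |x j - u j| := by
  have hKne : K.Nonempty := ⟨0, hK.mem_of_abs_le 0 fun i => by simpa using hr1⟩
  let vert : (Fin n → Bool) → Fin n → ℝ := fun b i => if b i then 1 else -1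
  have hvert : ∀ b i, vert b i = 1 ∨ vert b i = -1 := fun b i => by
    simp only [vert]
    split_ifs <;> simp
  obtain ⟨b₀, hb₀⟩ := Finite.exists_max fun b => Metric.infDist (vert b) K
  set r' := Metric.infDist (vert b₀) K with hr'
  have hclose : ∀ b, ∃ y ∈ K, ∀ i, |vert b i - y i| ≤ r' := fun b => by
    obtain ⟨y, hy, hd⟩ := hK.isCompact.exists_infDist_eq_dist hKne (vert b)
    refine ⟨y, hy, fun i => ?_⟩
    rw [← Real.dist_eq]
    exact (dist_le_pi_dist _ _ i).trans (hd ▸ hb₀ b)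
  have hr'0 : 0 < r' := by
    by_contra! hc
    refine hne (Set.Subset.antisymm (fun x hx => hK.abs_le_one x hx) fun x hx => ?_)
    refine cube_subset_of_vertices hK.convex (s := 1) (fun u hu => ?_) hx
    obtain ⟨y, hy, hyu⟩ := hclose fun i => decide (u i = 1)
    convert hy using 1
    ext i
    have h1 : vert (fun i => decide (u i = 1)) i = u i := by
      rcases hu i with h | h <;> simp [vert, h]
      norm_num
    have h2 := abs_nonpos_iff.1 ((hyu i).trans hc)
    rw [h1] at h2
    rw [one_smul]
    linarith
  refine ⟨r', vert b₀, hr'0, ?_, ⟨hK.convex, hK.isCompact, hK.abs_le_one, fun x hx => ?_⟩,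
    hvert b₀, fun x hx => ?_⟩
  · have h1 : (1 - r) • vert b₀ ∈ K := hK.mem_of_abs_le _ fun i => by
      rw [Pi.smul_apply, smul_eq_mul, abs_mul, abs_of_nonneg (by linarith)]
      rcases hvert b₀ i with h | h <;> simp [h]
    refine (Metric.infDist_le_dist_of_mem h1).trans ?_
    rw [dist_pi_le_iff hr]
    intro i
    rw [Real.dist_eq, Pi.smul_apply, smul_eq_mul, ← one_sub_mul, abs_mul, sub_sub_cancel,
      abs_of_nonneg hr]
    rcases hvert b₀ i with h | h <;> simp [h]
  · refine cube_subset_of_support hK.convex hK.isCompact.isClosed (fun g => ?_) hx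
    obtain ⟨y, hy, hyv⟩ := hclose fun i => decide (0 ≤ g i)
    refine ⟨y, hy, ?_⟩
    rw [Finset.mul_sum, dotProduct]
    refine Finset.sum_le_sum fun i _ => ?_
    have h1 : g i * vert (fun i => decide (0 ≤ g i)) i = |g i| := by
      rcases le_or_gt 0 (g i) with h | h
      · simp [vert, h, abs_of_nonneg h]
      · simp [vert, not_le.2 h, abs_of_neg h]
    have h2 : g i * (vert (fun i => decide (0 ≤ g i)) i - y i) ≤ |g i| * r' := by
      refine (le_abs_self _).trans ?_
      rw [abs_mul]
      exact mul_le_mul_of_nonneg_left (hyv i) (abs_nonneg _)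
    rw [mul_sub, h1] at h2
    linarith
  · by_contra! hc
    have h1 : dist (vert b₀) x < r' := by
      rw [dist_pi_lt_iff hr'0]
      intro i
      rw [dist_comm, Real.dist_eq]
      exact hc i
    exact absurd (Metric.infDist_le_dist_of_mem hx) (not_le.2 h1)

end Vertices

section Chords

variable {n : ℕ} {K : Set (Fin n → ℝ)} {r : ℝ}

theorem exists_maximal_chord (hK : IsCompact K) {w : Fin n → ℝ} {j : Fin n}
    (h : ∃ p ∈ K, ∀ i, i ≠ j → p i = w i) :
    ∃ p ∈ K, ∃ q ∈ K, (∀ i, i ≠ j → p i = w i) ∧ (∀ i, i ≠ j → q i = w i) ∧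
      ∀ z ∈ K, (∀ i, i ≠ j → z i = w i) → q j ≤ z j ∧ z j ≤ p j := by
  have hcl : IsClosed {p : Fin n → ℝ | ∀ i, i ≠ j → p i = w i} := by
    simp only [Set.ofPred_forall]
    exact isClosed_iInter fun i => isClosed_iInter fun _ =>
      isClosed_eq (continuous_apply i) continuous_const
  have hc := hK.inter_right hcl
  obtain ⟨p, hp, hpm⟩ := hc.exists_isMaxOn h (continuous_apply j).continuousOn
  obtain ⟨q, hq, hqm⟩ := hc.exists_isMinOn h (continuous_apply j).continuousOn
  exact ⟨p, hp.1, q, hq.1, hp.2, hq.2, fun z hz hzw => ⟨hqm ⟨hz, hzw⟩, hpm ⟨hz, hzw⟩⟩⟩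

theorem exists_short_chord (hK : Convex ℝ K) {η : ℝ} (hη : η ≤ 1) {j : Fin n} {τ β κ : ℝ}
    (h0 : ∀ z ∈ K, (∀ i, i ≠ j → z i = 0) → β ≤ z j ∧ z j ≤ τ)
    (hw : ∃ p ∈ K, ∃ q ∈ K, p j = 1 ∧ q j = -1 ∧ ∀ i, i ≠ j → p i = q i ∧ |p i| ≤ 1)
    (hκ : (2 - η) * (τ - β) < κ + 2 * (1 - η)) :
    ∃ u : Fin n → ℝ, (∀ i, u i = 1 ∨ u i = -1) ∧ ∀ p ∈ K, ∀ q ∈ K,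
      (∀ i, i ≠ j → p i = (1 - η) * u i) → (∀ i, i ≠ j → q i = (1 - η) * u i) → p j - q j < κ := by
  by_contra! hcon
  let C : Set (Fin n → ℝ) := {w | ∃ p ∈ K, ∃ q ∈ K, (∀ i, i ≠ j → p i = w i) ∧
    (∀ i, i ≠ j → q i = w i) ∧ κ ≤ p j - q j}
  have hC : Convex ℝ C := by
    rintro w ⟨p, hp, q, hq, hpw, hqw, h⟩ w' ⟨p', hp', q', hq', hpw', hqw', h'⟩ a b ha hb hab
    refine ⟨a • p + b • p', hK hp hp' ha hb hab, a • q + b • q', hK hq hq' ha hb hab,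
      fun i hi => ?_, fun i hi => ?_, ?_⟩
    · simp [hpw i hi, hpw' i hi]
    · simp [hqw i hi, hqw' i hi]
    · simp only [Pi.add_apply, Pi.smul_apply, smul_eq_mul]
      calc κ = a * κ + b * κ := by rw [← add_mul, hab, one_mul]
        _ ≤ a * (p j - q j) + b * (p' j - q' j) := add_le_add
          (mul_le_mul_of_nonneg_left h ha) (mul_le_mul_of_nonneg_left h' hb)
        _ = _ := by ring
  obtain ⟨p, hp, q, hq, hpj, hqj, hpq⟩ := hw
  have hmem : (fun i => if i = j then 0 else -((1 - η) * p i)) ∈ C := by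
    refine cube_subset_of_vertices hC (s := 1 - η) (fun u hu => ?_) fun i => ?_
    · obtain ⟨p, hp, q, hq, h1, h2, h3⟩ := hcon u hu
      exact ⟨p, hp, q, hq, h1, h2, h3⟩
    · split_ifs with hi
      · simpa using hη
      · rw [abs_neg, abs_mul, abs_of_nonneg (by linarith)]
        exact mul_le_of_le_one_right (by linarith) (hpq i hi).2
  obtain ⟨p', hp', q', hq', hpw, hqw, h⟩ := hmem
  have h2 : 0 < 2 - η := by linarith
  have hab : 1 / (2 - η) + (1 - η) / (2 - η) = 1 := by
    rw [← add_div, div_eq_one_iff_eq h2.ne']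
    ring
  have ha : 0 ≤ 1 / (2 - η) := by positivity
  have hb : 0 ≤ (1 - η) / (2 - η) := div_nonneg (by linarith) h2.le
  have h3 := (h0 _ (hK hp' hp ha hb hab) fun i hi => by
    simp only [Pi.add_apply, Pi.smul_apply, smul_eq_mul, hpw i hi, if_neg hi]
    field_simp
    ring).2
  have h4 := (h0 _ (hK hq' hq ha hb hab) fun i hi => by
    simp only [Pi.add_apply, Pi.smul_apply, smul_eq_mul, hqw i hi, if_neg hi, ← (hpq i hi).1]
    field_simp
    ring).1
  simp only [Pi.add_apply, Pi.smul_apply, smul_eq_mul, hpj, hqj] at h3 h4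
  have h5 : (1 / (2 - η)) * (p' j - q' j + 2 * (1 - η)) ≤ τ - β := by
    have : (1 / (2 - η)) * (p' j - q' j + 2 * (1 - η)) =
      (1 / (2 - η) * p' j + (1 - η) / (2 - η) * 1) -
        (1 / (2 - η) * q' j + (1 - η) / (2 - η) * -1) := by ring
    rw [this]
    linarith
  rw [one_div, inv_mul_le_iff₀ h2] at h5
  linarith

/-- A near-cube which touches opposite facets of the cube in points with equal remaining
coordinates, and is not the cube, can be illuminated by `2 ^ n - 1` directions. -/
theorem NearCube.illuminable (hK : NearCube K r) {η : ℝ} (hη0 : 0 < η)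
    (hη : η * (4000 * (n + 1) ^ 2) ≤ 1) (hr0 : 0 ≤ r) (hr : 16 * r ≤ η)
    (hw : ∀ j, ∃ p ∈ K, ∃ q ∈ K, p j = 1 ∧ q j = -1 ∧ ∀ i, i ≠ j → p i = q i)
    (hne : K ≠ {y | ∀ i, |y i| ≤ 1}) : Illuminable K (2 ^ n - 1) := by
  have hn : (0 : ℝ) ≤ n := Nat.cast_nonneg n
  have hηn : 0 ≤ η * n := mul_nonneg hη0.le hn
  have hηnn : 0 ≤ η * n * n := mul_nonneg hηn hn
  have hη1 : η ≤ 1 / 4000 := by linarith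
  obtain ⟨s, v, hs0, hsr, hKs, hv, hvK⟩ := hK.exists_vertex hr0 (by linarith) hne
  have hmul : ∀ (u : Fin n → ℝ) j t, u * Pi.single j t = Pi.single j (u j * t) := fun u j t => by
    ext i
    by_cases hi : i = j
    · subst hi; simp
    · simp [hi]
  have hsing : ∀ (j : Fin n) (p : Fin n → ℝ), (∀ i, i ≠ j → p i = 0) → p = Pi.single j (p j) := by
    intro j p hp
    ext i
    by_cases hi : i = j
    · subst hi; simp
    · simp [hi, hp i hi]
  by_cases hax : ∀ j, (Pi.single j (1 - s / 100) : Fin n → ℝ) ∈ K ∧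
      (Pi.single j (-(1 - s / 100)) : Fin n → ℝ) ∈ K
  · have hv' : ∀ i, -v i = 1 ∨ -v i = -1 := fun i => by
      rcases hv i with h | h <;> simp [h]
    refine Illuminable.of_sign (u := -v) hv' ?_
    refine (hKs.sign hv').illuminable_of_axes hs0 (ρ := η / 2) (by linarith) (by linarith)
      (by linarith) (fun x hx => ?_) fun j => ?_
    · obtain ⟨j, hj⟩ := hvK _ hx
      refine ⟨j, ?_⟩
      have h1 := abs_le.1 (hKs.abs_le_one _ hx j)
      simp only [Pi.mul_apply] at hj h1
      rcases hv j with h | h <;> rw [h] at hj h1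
      · rw [abs_of_nonpos (by linarith)] at hj
        linarith
      · rw [abs_of_nonneg (by linarith)] at hj
        linarith
    · simp only [Set.mem_ofPred_eq, hmul]
      rcases hv j with h | h <;> rw [h]
      · simpa using (hax j).symm
      · simpa using hax j
  · push Not at hax
    obtain ⟨j, hj⟩ := hax
    have h0K : (0 : Fin n → ℝ) ∈ K := hKs.mem_of_abs_le 0 fun i => by simp; linarith
    obtain ⟨p, hp, q, hq, hp0, hq0, hmax⟩ := exists_maximal_chord hKs.isCompact (w := 0) (j := j)
      ⟨0, h0K, fun i _ => rfl⟩
    rw [hsing j p hp0] at hp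
    rw [hsing j q hq0] at hq
    generalize p j = τ at *
    generalize q j = β at *
    have hτ1 : τ ≤ 1 := by simpa using (abs_le.1 (hKs.abs_le_one _ hp j)).2
    have hβ1 : -1 ≤ β := by simpa using (abs_le.1 (hKs.abs_le_one _ hq j)).1
    have hin : ∀ t : ℝ, |t| ≤ 1 - s → β ≤ t ∧ t ≤ τ := fun t ht => by
      have := hmax (Pi.single j t) (hKs.mem_of_abs_le _ fun i => ?_) fun i hi => by simp [hi]
      · simpa using this
      · by_cases hi : i = j
        · subst hi; simpa using ht
        · simp [hi]; linarith
    have hτs := (hin (1 - s) (by rw [abs_of_nonneg]; linarith)).2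
    have hβs := (hin (-(1 - s)) (by rw [abs_neg, abs_of_nonneg]; linarith)).1
    have hL : τ - β < 2 - s / 100 := by
      by_contra! hc
      have hscale : ∀ a b : ℝ, (Pi.single j a : Fin n → ℝ) ∈ K → 0 < b → b ≤ |a| →
          (Pi.single j (b / |a| * a) : Fin n → ℝ) ∈ K := fun a b ha hb hba => by
        have := hKs.convex.smul_mem_of_zero_mem h0K ha (t := b / |a|)
          ⟨by positivity, by rw [div_le_one (by linarith)]; exact hba⟩
        rwa [← Pi.single_smul, smul_eq_mul] at this
      refine hj ?_ ?_
      · have h1 : |τ| = τ := abs_of_nonneg (by linarith)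
        have := hscale τ (1 - s / 100) hp (by linarith) (by rw [h1]; linarith)
        rwa [h1, div_mul_cancel₀ _ (by linarith)] at this
      · have h1 : |β| = -β := abs_of_nonpos (by linarith)
        have := hscale β (1 - s / 100) hq (by linarith) (by rw [h1]; linarith)
        rwa [h1, div_neg, neg_mul, div_mul_cancel₀ _ (by linarith)] at this
    obtain ⟨u, hu, hshort⟩ := exists_short_chord hKs.convex (η := η) (κ := τ - β - s / 200)
      (by linarith) hmax (by
        obtain ⟨p, hp, q, hq, h1, h2, h3⟩ := hw j
        exact ⟨p, hp, q, hq, h1, h2, fun i hi => ⟨h3 i hi, hKs.abs_le_one p hp i⟩⟩) (by nlinarith)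
    have hu' : ∀ i, -u i = 1 ∨ -u i = -1 := fun i => by
      rcases hu i with h | h <;> simp [h]
    refine Illuminable.of_sign (u := -u) hu' ?_
    have hK' := hKs.sign hu'
    obtain ⟨p', hp', q', hq', hpw, hqw, hmax'⟩ := exists_maximal_chord hK'.isCompact
      (w := fun _ => -(1 - η)) (j := j) ⟨fun _ => -(1 - η), hK'.mem_of_abs_le _ fun i => by
        rw [abs_neg, abs_of_nonneg] <;> linarith, fun i _ => rfl⟩
    have hpi : ∀ i, i ≠ j → (-u * p') i = (1 - η) * u i := fun i hi => by
      simp [hpw i hi]; ring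
    have hqi : ∀ i, i ≠ j → (-u * q') i = (1 - η) * u i := fun i hi => by
      simp [hqw i hi]; ring
    have h1 := hshort _ hp' _ hq' hpi hqi
    have h2 := hshort _ hq' _ hp' hqi hpi
    simp only [Pi.mul_apply] at h1 h2
    have hp'1 := (abs_le.1 (hK'.abs_le_one _ hp' j)).2
    have hq'1 := (abs_le.1 (hK'.abs_le_one _ hq' j)).1
    rcases hu j with h | h <;> rw [h] at h1 h2
    · exact hK'.illuminable_of_chord hs0 hη0 hη (by linarith) (j := j) (τ₀ := -β) (β₀ := -τ)
        (τ := p' j) (β := q' j) (by simpa [hmul, h] using hq) (by simpa [hmul, h] using hp)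
        (by linarith) (by linarith) hp'1 hq'1 hmax' (by linarith)
    · exact hK'.illuminable_of_chord hs0 hη0 hη (by linarith) (j := j) (τ₀ := τ) (β₀ := β)
        (τ := p' j) (β := q' j) (by simpa [hmul, h] using hp) (by simpa [hmul, h] using hq)
        (by linarith) (by linarith) hp'1 hq'1 hmax' (by linarith)

end Chords

section DiagonalEstimates

variable {n : ℕ} {A : Matrix (Fin n) (Fin n) ℝ}

theorem abs_det_le_sum_perm : |A.det| ≤ ∑ σ : Equiv.Perm (Fin n), ∏ i, |A i (σ i)| := by
  rw [← Matrix.det_transpose, Matrix.det_apply']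
  refine (Finset.abs_sum_le_sum_abs _ _).trans (Finset.sum_le_sum fun σ _ => ?_)
  rw [abs_mul, Finset.abs_prod]
  simp only [Matrix.transpose_apply]
  refine mul_le_of_le_one_left (Finset.prod_nonneg fun i _ => abs_nonneg _) ?_
  rcases Int.units_eq_one_or (Equiv.Perm.sign σ) with h | h <;> simp [h]

theorem prod_sum_abs : ∏ i, ∑ k, |A i k| = ∑ f : Fin n → Fin n, ∏ i, |A i (f i)| := by
  rw [Finset.prod_univ_sum, Fintype.piFinset_univ]

theorem abs_det_add_le (i : Fin n) :
    |A.det| + ∑ k ∈ Finset.univ.erase i, |A i k| * ∏ l ∈ Finset.univ.erase i, |A l l| ≤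
      ∏ i, ∑ k, |A i k| := by
  classical
  rw [prod_sum_abs]
  let F : (Fin n → Fin n) → ℝ := fun f => ∏ i, |A i (f i)|
  have hperm : ∑ σ : Equiv.Perm (Fin n), ∏ i, |A i (σ i)| =
      ∑ f ∈ Finset.univ.image (fun σ : Equiv.Perm (Fin n) => (σ : Fin n → Fin n)), F f := by
    rw [Finset.sum_image fun σ _ τ _ h => DFunLike.coe_injective h]
  have hupd : ∑ k ∈ Finset.univ.erase i, |A i k| * ∏ l ∈ Finset.univ.erase i, |A l l| =
      ∑ f ∈ (Finset.univ.erase i).image (fun k => Function.update id i k), F f := by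
    rw [Finset.sum_image fun k _ l _ h => by simpa using congrFun h i]
    refine Finset.sum_congr rfl fun k _ => ?_
    simp only [F]
    rw [← Finset.mul_prod_erase _ _ (Finset.mem_univ i), Function.update_self]
    congr 1
    refine Finset.prod_congr rfl fun l hl => ?_
    rw [Function.update_of_ne (Finset.ne_of_mem_erase hl), id]
  have hdisj : Disjoint (Finset.univ.image (fun σ : Equiv.Perm (Fin n) => (σ : Fin n → Fin n)))
      ((Finset.univ.erase i).image (fun k => Function.update id i k)) := by
    rw [Finset.disjoint_left]
    intro f hf hf'
    obtain ⟨σ, -, rfl⟩ := Finset.mem_image.1 hf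
    obtain ⟨k, hk, h⟩ := Finset.mem_image.1 hf'
    have hki := Finset.ne_of_mem_erase hk
    refine hki (σ.injective ?_)
    rw [← h]
    simp [Function.update_of_ne hki]
  calc _ ≤ (∑ σ : Equiv.Perm (Fin n), ∏ i, |A i (σ i)|) +
        ∑ k ∈ Finset.univ.erase i, |A i k| * ∏ l ∈ Finset.univ.erase i, |A l l| :=
        add_le_add abs_det_le_sum_perm le_rfl
    _ ≤ _ := by
        rw [hperm, hupd, ← Finset.sum_union hdisj]
        exact Finset.sum_le_univ_sum_of_nonneg fun f => Finset.prod_nonneg fun i _ => abs_nonneg _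

/-- A matrix with determinant at least one, row sums at most about one and large diagonal entries
is diagonally dominant, with dominance close to one. -/
theorem diagonal_dominance {R μ : ℝ} (hR1 : 1 ≤ R) (hR : R ^ n ≤ 1 + μ)
    (hrow : ∀ i, ∑ k, |A i k| ≤ R) (hdiag : ∀ i, 3 / 4 ≤ A i i) (hdet : 1 ≤ A.det) (i : Fin n) :
    1 - 3 * μ * (4 / 3) ^ n ≤ A i i - ∑ k ∈ Finset.univ.erase i, |A i k| := by
  set b := ∑ k ∈ Finset.univ.erase i, |A i k| with hb
  have hdet' : 1 ≤ |A.det| := hdet.trans (le_abs_self _)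
  have hprod : ∏ i, ∑ k, |A i k| ≤ R ^ n := by
    calc _ ≤ ∏ _i : Fin n, R := Finset.prod_le_prod
          (fun i _ => Finset.sum_nonneg fun k _ => abs_nonneg _) fun i _ => hrow i
      _ = R ^ n := by simp
  have hb0 : 0 ≤ b := Finset.sum_nonneg fun k _ => abs_nonneg _
  have h1 := (abs_det_add_le (A := A) i).trans hprod
  rw [← Finset.sum_mul, ← hb] at h1
  have h2 : (3 / 4 : ℝ) ^ n ≤ ∏ l ∈ Finset.univ.erase i, |A l l| := by
    calc (3 / 4 : ℝ) ^ n ≤ (3 / 4 : ℝ) ^ (Finset.univ.erase i).card :=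
          pow_le_pow_of_le_one (by norm_num) (by norm_num)
            ((Finset.card_erase_le).trans (by simp))
      _ = ∏ l ∈ Finset.univ.erase i, (3 / 4 : ℝ) := by rw [Finset.prod_const]
      _ ≤ _ := Finset.prod_le_prod (fun l _ => by norm_num)
          fun l _ => (hdiag l).trans (le_abs_self _)
  have h3 : b * (3 / 4 : ℝ) ^ n ≤ μ := by
    have := mul_le_mul_of_nonneg_left h2 hb0
    linarith
  have h4 : b ≤ μ * (4 / 3) ^ n := by
    calc b = b * (3 / 4 : ℝ) ^ n * (4 / 3) ^ n := by
          rw [mul_assoc, ← mul_pow]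
          norm_num
      _ ≤ _ := mul_le_mul_of_nonneg_right h3 (by positivity)
  have h5 : 1 ≤ (A i i + b) * R ^ n := by
    have h6 := hdet'.trans ((le_add_of_nonneg_right (by positivity)).trans (abs_det_add_le (A := A) i))
    rw [← Finset.mul_prod_erase _ _ (Finset.mem_univ i)] at h6
    refine h6.trans (mul_le_mul ?_ ?_ ?_ ?_)
    · rw [← Finset.add_sum_erase _ _ (Finset.mem_univ i), ← hb,
        abs_of_nonneg (by linarith [hdiag i] : 0 ≤ A i i)]
    · calc _ ≤ ∏ _i ∈ Finset.univ.erase i, R := Finset.prod_le_prod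
            (fun i _ => Finset.sum_nonneg fun k _ => abs_nonneg _) fun i _ => hrow i
        _ = R ^ (Finset.univ.erase i).card := by simp
        _ ≤ R ^ n := pow_le_pow_right₀ hR1 ((Finset.card_erase_le).trans (by simp))
    · exact Finset.prod_nonneg fun i _ => Finset.sum_nonneg fun k _ => abs_nonneg _
    · linarith [hdiag i]
  have h6 : 1 ≤ R ^ n := one_le_pow₀ hR1
  have h7 : 1 - μ ≤ A i i + b := by
    have : 0 ≤ A i i + b := by linarith [hdiag i]
    by_contra! hc
    nlinarith
  have h8 : (1 : ℝ) ≤ (4 / 3) ^ n := one_le_pow₀ (by norm_num)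
  nlinarith

theorem sum_abs_vecMul_ge {ν : ℝ}
    (hA : ∀ i, 1 - ν ≤ A i i - ∑ k ∈ Finset.univ.erase i, |A i k|) (g : Fin n → ℝ) :
    (1 - ν) * ∑ i, |g i| ≤ ∑ k, |(Matrix.vecMul g A) k| := by
  have h1 : ∀ k, |g k| * A k k - ∑ i ∈ Finset.univ.erase k, |g i| * |A i k| ≤
      |(Matrix.vecMul g A) k| := by
    intro k
    have h2 : (Matrix.vecMul g A) k = g k * A k k + ∑ i ∈ Finset.univ.erase k, g i * A i k :=
      (Finset.add_sum_erase _ _ (Finset.mem_univ k)).symm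
    have h3 : |∑ i ∈ Finset.univ.erase k, g i * A i k| ≤
        ∑ i ∈ Finset.univ.erase k, |g i| * |A i k| := by
      refine (Finset.abs_sum_le_sum_abs _ _).trans (le_of_eq ?_)
      exact Finset.sum_congr rfl fun i _ => abs_mul _ _
    have h4 : |g k| * A k k ≤ |g k * A k k| := by
      rw [abs_mul]
      exact mul_le_mul_of_nonneg_left (le_abs_self _) (abs_nonneg _)
    have h5 := abs_sub_abs_le_abs_add (g k * A k k) (∑ i ∈ Finset.univ.erase k, g i * A i k)
    rw [h2]
    linarith
  have h2 : ∑ k, ∑ i ∈ Finset.univ.erase k, |g i| * |A i k| =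
      ∑ i, ∑ k ∈ Finset.univ.erase i, |g i| * |A i k| := by
    refine Finset.sum_comm' fun k i => ?_
    simp [ne_comm]
  calc (1 - ν) * ∑ i, |g i| ≤ ∑ i, (|g i| * (A i i - ∑ k ∈ Finset.univ.erase i, |A i k|)) := by
        rw [Finset.mul_sum]
        refine Finset.sum_le_sum fun i _ => ?_
        rw [mul_comm]
        exact mul_le_mul_of_nonneg_left (hA i) (abs_nonneg _)
    _ = ∑ k, (|g k| * A k k - ∑ i ∈ Finset.univ.erase k, |g i| * |A i k|) := by
        rw [Finset.sum_sub_distrib, h2, ← Finset.sum_sub_distrib]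
        refine Finset.sum_congr rfl fun i _ => ?_
        rw [mul_sub, Finset.mul_sum]
    _ ≤ _ := Finset.sum_le_sum fun k _ => h1 k

end DiagonalEstimates

section MaximalDeterminant

variable {n : ℕ} {K : Set (Fin n → ℝ)}

/-- The matrices with large diagonal which map `K` to a set of width at most two in all coordinate
directions. -/
def widthMatrices (K : Set (Fin n → ℝ)) : Set (Matrix (Fin n) (Fin n) ℝ) :=
  {A | (∀ x ∈ K, ∀ y ∈ K, ∀ i, A i ⬝ᵥ (x - y) ≤ 2) ∧ ∀ i, 3 / 4 ≤ A i i}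

theorem widthMatrices.sum_abs_le {ρ : ℝ} (hρ : ρ < 1)
    (hsup : ∀ g : Fin n → ℝ, ∃ y ∈ K, (1 - ρ) * ∑ i, |g i| ≤ g ⬝ᵥ y)
    {A : Matrix (Fin n) (Fin n) ℝ} (hA : A ∈ widthMatrices K) (i : Fin n) :
    ∑ k, |A i k| ≤ (1 - ρ)⁻¹ := by
  obtain ⟨x, hx, h1⟩ := hsup (A i)
  obtain ⟨y, hy, h2⟩ := hsup (-A i)
  have h3 := hA.1 x hx y hy i
  rw [dotProduct_sub] at h3
  rw [neg_dotProduct] at h2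
  simp only [Pi.neg_apply, abs_neg] at h2
  rw [← one_div, le_div_iff₀ (by linarith)]
  linarith

theorem isCompact_widthMatrices {ρ : ℝ} (hρ : ρ < 1)
    (hsup : ∀ g : Fin n → ℝ, ∃ y ∈ K, (1 - ρ) * ∑ i, |g i| ≤ g ⬝ᵥ y) :
    IsCompact (widthMatrices K) := by
  have hcl : IsClosed (widthMatrices K) := by
    have : widthMatrices K = (⋂ x ∈ K, ⋂ y ∈ K, ⋂ i, {A | A i ⬝ᵥ (x - y) ≤ 2}) ∩
        ⋂ i, {A | 3 / 4 ≤ A i i} := by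
      ext A
      simp [widthMatrices]
    rw [this]
    simp only [dotProduct]
    refine (isClosed_biInter fun x _ => isClosed_biInter fun y _ => isClosed_iInter fun i =>
      isClosed_le (by fun_prop) (by fun_prop)).inter (isClosed_iInter fun i =>
      isClosed_le (by fun_prop) (by fun_prop))
  have hbox : IsCompact (Set.univ.pi fun _ : Fin n => Set.univ.pi fun _ : Fin n =>
      Set.Icc (-(1 - ρ)⁻¹) (1 - ρ)⁻¹) :=
    isCompact_univ_pi fun _ => isCompact_univ_pi fun _ => isCompact_Icc
  refine IsCompact.of_isClosed_subset hbox hcl fun A hA i _ k _ => ?_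
  rw [Set.mem_Icc, ← abs_le]
  exact (Finset.single_le_sum (f := fun k => |A i k|) (fun k _ => abs_nonneg _)
    (Finset.mem_univ k)).trans (widthMatrices.sum_abs_le hρ hsup hA i)

/-- The image of `K` under a matrix of maximal determinant touches opposite facets in the
coordinate directions. -/
theorem exists_mulVec_sub_eq (hK : Convex ℝ K) (hKc : IsCompact K) (hne : K.Nonempty)
    {A : Matrix (Fin n) (Fin n) ℝ} (hA : A ∈ widthMatrices K)
    (hmax : ∀ B ∈ widthMatrices K, B.det ≤ A.det) (hdet : 0 < A.det)
    (hdiag : ∀ i, 7 / 8 ≤ A i i) (j : Fin n) :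
    ∃ x ∈ K, ∃ y ∈ K, A.mulVec (x - y) = Pi.single j 2 := by
  by_contra! hcon
  let W : Set (Fin n → ℝ) := A.mulVecLin '' (K - K)
  have hW : Convex ℝ W := (hK.sub hK).linear_image _
  have hWc : IsClosed W := by
    simp only [W, sub_eq_add_neg]
    exact ((hKc.add hKc.neg).image (LinearMap.continuous_of_finiteDimensional A.mulVecLin)).isClosed
  have hjW : Pi.single j 2 ∉ W := by
    rintro ⟨_, ⟨x, hx, y, hy, rfl⟩, h⟩
    exact hcon x hx y hy h
  obtain ⟨φ, u, hu1, hu2⟩ := geometric_hahn_banach_closed_point hW hWc hjW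
  obtain ⟨g, hg⟩ := continuousLinearMap_eq_dotProduct φ
  have hu0 : 0 < u := by
    obtain ⟨x, hx⟩ := hne
    have := hu1 (A.mulVecLin (x - x)) ⟨_, Set.sub_mem_sub hx hx, rfl⟩
    simpa using this
  have hgj : u < g j * 2 := by
    rw [hg, dotProduct_single] at hu2
    exact hu2
  set c : Fin n → ℝ := (2 / u) • g with hc
  have hcj : 1 < c j := by
    rw [hc, Pi.smul_apply, smul_eq_mul, div_mul_eq_mul_div, lt_div_iff₀ hu0]
    linarith
  set w : Fin n → ℝ := ∑ k, c k • A k with hw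
  have hwxy : ∀ x ∈ K, ∀ y ∈ K, w ⬝ᵥ (x - y) ≤ 2 := by
    intro x hx y hy
    have h1 := hu1 _ ⟨_, Set.sub_mem_sub hx hy, rfl⟩
    rw [hg, Matrix.mulVecLin_apply] at h1
    have h2 : w ⬝ᵥ (x - y) = c ⬝ᵥ A.mulVec (x - y) := by
      rw [hw, sum_dotProduct]
      exact Finset.sum_congr rfl fun k _ => by rw [smul_dotProduct, smul_eq_mul]; rfl
    rw [h2, hc, smul_dotProduct, smul_eq_mul, div_mul_eq_mul_div, div_le_iff₀ hu0]
    linarith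
  set s : ℝ := 1 / (8 * (1 + |w j - A j j|)) with hs
  have hs0 : 0 < s := by positivity
  have hs1 : s * (1 + |w j - A j j|) = 1 / 8 := by
    rw [hs]
    field_simp
  have hs2 : s ≤ 1 / 8 := by nlinarith [abs_nonneg (w j - A j j)]
  let B := A.updateRow j ((1 - s) • A j + s • w)
  have hB : B ∈ widthMatrices K := by
    refine ⟨fun x hx y hy i => ?_, fun i => ?_⟩
    · by_cases hi : i = j
      · subst hi
        simp only [B, Matrix.updateRow_self]
        rw [add_dotProduct, smul_dotProduct, smul_dotProduct, smul_eq_mul, smul_eq_mul]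
        nlinarith [hA.1 x hx y hy i, hwxy x hx y hy]
      · simp only [B, Matrix.updateRow_ne hi]
        exact hA.1 x hx y hy i
    · by_cases hi : i = j
      · subst hi
        simp only [B, Matrix.updateRow_self, Pi.add_apply, Pi.smul_apply, smul_eq_mul]
        nlinarith [hdiag i, neg_abs_le (w i - A i i)]
      · simp only [B, Matrix.updateRow_ne hi]
        exact hA.2 i
  have hdetB : B.det = (1 - s) * A.det + s * (c j * A.det) := by
    simp only [B]
    rw [Matrix.det_updateRow_add, Matrix.det_updateRow_smul, Matrix.det_updateRow_smul,
      Matrix.updateRow_eq_self, hw, Matrix.det_updateRow_sum, smul_eq_mul]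
  have h1 := hmax B hB
  rw [hdetB] at h1
  have h2 : 0 < s * ((c j - 1) * A.det) := mul_pos hs0 (mul_pos (by linarith) hdet)
  linarith

end MaximalDeterminant

section Normalization

variable {n : ℕ} {K : Set (Fin n → ℝ)}

theorem exists_widthMatrix {ρ μ ν : ℝ} (hρ0 : 0 ≤ ρ) (hρ : ρ < 1) (hρμ : ((1 - ρ)⁻¹) ^ n ≤ 1 + μ)
    (hμ : 3 * μ * (4 / 3) ^ n ≤ ν) (hν : ν ≤ 1 / 8) (hK : Convex ℝ K) (hKc : IsCompact K)
    (hne : K.Nonempty) (hKQ : ∀ x ∈ K, ∀ i, |x i| ≤ 1)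
    (hsup : ∀ g : Fin n → ℝ, ∃ y ∈ K, (1 - ρ) * ∑ i, |g i| ≤ g ⬝ᵥ y) :
    ∃ A : Matrix (Fin n) (Fin n) ℝ, 0 < A.det ∧ A ∈ widthMatrices K ∧
      (∀ i, 1 - ν ≤ A i i - ∑ k ∈ Finset.univ.erase i, |A i k|) ∧
      ∀ j, ∃ x ∈ K, ∃ y ∈ K, A.mulVec (x - y) = Pi.single j 2 := by
  have hone : (1 : Matrix (Fin n) (Fin n) ℝ) ∈ widthMatrices K := by
    refine ⟨fun x hx y hy i => ?_, fun i => by rw [Matrix.one_apply_eq]; norm_num⟩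
    have h : (1 : Matrix (Fin n) (Fin n) ℝ) i ⬝ᵥ (x - y) = (x - y) i :=
      congrFun (Matrix.one_mulVec (x - y)) i
    rw [h, Pi.sub_apply]
    linarith [(abs_le.1 (hKQ x hx i)).2, (abs_le.1 (hKQ y hy i)).1]
  obtain ⟨A, hA, hmax⟩ := (isCompact_widthMatrices hρ hsup).exists_isMaxOn ⟨1, hone⟩
    (continuous_id.matrix_det).continuousOn
  have hmax' : ∀ B ∈ widthMatrices K, B.det ≤ A.det := fun B hB => hmax hB
  have hdet : 1 ≤ A.det := by simpa using hmax' 1 hone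
  have hdom : ∀ i, 1 - ν ≤ A i i - ∑ k ∈ Finset.univ.erase i, |A i k| := fun i =>
    le_trans (by linarith) (diagonal_dominance ((one_le_inv₀ (by linarith)).2 (by linarith)) hρμ
      (widthMatrices.sum_abs_le hρ hsup hA) hA.2 hdet i)
  refine ⟨A, by linarith, hA, hdom, exists_mulVec_sub_eq hK hKc hne hA hmax' (by linarith)
    fun i => ?_⟩
  have h1 : 0 ≤ ∑ k ∈ Finset.univ.erase i, |A i k| := Finset.sum_nonneg fun k _ => abs_nonneg _
  linarith [hdom i]

theorem exists_affineEquiv_nearCube {ρ μ ν : ℝ} (hρ0 : 0 ≤ ρ) (hρν : ρ ≤ ν)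
    (hρμ : ((1 - ρ)⁻¹) ^ n ≤ 1 + μ)
    (hμ : 3 * μ * (4 / 3) ^ n ≤ ν) (hν : ν ≤ 1 / 8) (hK : Convex ℝ K) (hKc : IsCompact K)
    (hKQ : ∀ x ∈ K, ∀ i, |x i| ≤ 1)
    (hsup : ∀ g : Fin n → ℝ, ∃ y ∈ K, (1 - ρ) * ∑ i, |g i| ≤ g ⬝ᵥ y) :
    ∃ T : (Fin n → ℝ) ≃ᵃ[ℝ] (Fin n → ℝ), NearCube (T '' K) (4 * ν) ∧
      ∀ j, ∃ p ∈ T '' K, ∃ q ∈ T '' K, p j = 1 ∧ q j = -1 ∧ ∀ i, i ≠ j → p i = q i := by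
  have hne : K.Nonempty := by
    obtain ⟨y, hy, -⟩ := hsup 0
    exact ⟨y, hy⟩
  obtain ⟨A, hdet, hA, hdom, htouch⟩ := exists_widthMatrix hρ0 (by linarith) hρμ hμ hν hK hKc hne
    hKQ hsup
  have hsupA : ∀ g : Fin n → ℝ, ∃ y ∈ K, (1 - 2 * ν) * ∑ i, |g i| ≤ g ⬝ᵥ A.mulVec y := by
    intro g
    obtain ⟨y, hy, h⟩ := hsup (Matrix.vecMul g A)
    refine ⟨y, hy, ?_⟩
    rw [Matrix.dotProduct_mulVec]
    refine le_trans ?_ h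
    have h1 := sum_abs_vecMul_ge hdom g
    have h2 : 0 ≤ ∑ i, |g i| := Finset.sum_nonneg fun i _ => abs_nonneg _
    calc (1 - 2 * ν) * ∑ i, |g i| ≤ (1 - ρ) * ((1 - ν) * ∑ i, |g i|) := by
          rw [← mul_assoc]
          exact mul_le_mul_of_nonneg_right (by nlinarith) h2
      _ ≤ _ := mul_le_mul_of_nonneg_left h1 (by linarith)
  choose p hp q hq hpq using htouch
  have hpqi : ∀ i, A.mulVec (p i) i - A.mulVec (q i) i = 2 := fun i => by
    have := congrFun (hpq i) i
    rw [Matrix.mulVec_sub, Pi.sub_apply, Pi.single_eq_same] at this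
    exact this
  have hwidth : ∀ x ∈ K, ∀ y ∈ K, ∀ i, A.mulVec x i - A.mulVec y i ≤ 2 := fun x hx y hy i => by
    rw [← Pi.sub_apply, ← Matrix.mulVec_sub]
    exact hA.1 x hx y hy i
  let b : Fin n → ℝ := fun i => 1 - A.mulVec (p i) i
  have hrange : ∀ x ∈ K, ∀ i, |b i + A.mulVec x i| ≤ 1 := by
    intro x hx i
    have h1 := hwidth x hx (q i) (hq i) i
    have h2 := hwidth (p i) (hp i) x hx i
    have h3 := hpqi i
    rw [abs_le]
    constructor <;> simp only [b] <;> linarith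
  have hb : ∀ i, |b i| ≤ 2 * ν := by
    intro i
    have hsing : ∀ t : ℝ, ∑ k, |(Pi.single i t : Fin n → ℝ) k| = |t| := fun t => by
      rw [Finset.sum_eq_single i]
      · simp
      · intro k _ hk
        simp [hk]
      · simp
    obtain ⟨y, hy, h1⟩ := hsupA (Pi.single i 1)
    obtain ⟨z, hz, h2⟩ := hsupA (Pi.single i (-1))
    rw [hsing, single_dotProduct] at h1 h2
    simp only [abs_one, abs_neg, mul_one, one_mul] at h1 h2
    have h3 := abs_le.1 (hrange y hy i)
    have h4 := abs_le.1 (hrange z hz i)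
    rw [abs_le]
    constructor <;> linarith
  let L := Matrix.toLinearEquiv' A (Matrix.invertibleOfIsUnitDet A hdet.ne'.isUnit)
  have hL : ∀ x, L x = A.mulVec x := fun x => rfl
  let T : (Fin n → ℝ) ≃ᵃ[ℝ] (Fin n → ℝ) :=
    L.toAffineEquiv.trans (AffineEquiv.constVAdd ℝ (Fin n → ℝ) b)
  have hT : ∀ x, T x = b + A.mulVec x := fun x => rfl
  have hTK : Convex ℝ (T '' K) := hK.affine_image T.toAffineMap
  have hTKc : IsCompact (T '' K) := hKc.image T.toContinuousAffineEquiv.continuous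
  refine ⟨T, ⟨hTK, hTKc, ?_, fun x hx => ?_⟩, fun j => ?_⟩
  · rintro _ ⟨x, hx, rfl⟩ i
    rw [hT]
    exact hrange x hx i
  · refine cube_subset_of_support hTK hTKc.isClosed (fun g => ?_) hx
    obtain ⟨y, hy, h⟩ := hsupA g
    refine ⟨T y, ⟨y, hy, rfl⟩, ?_⟩
    rw [hT, dotProduct_add]
    have h1 : -(2 * ν * ∑ i, |g i|) ≤ g ⬝ᵥ b := by
      rw [dotProduct, Finset.mul_sum, ← Finset.sum_neg_distrib]
      refine Finset.sum_le_sum fun i _ => ?_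
      have h2 : |g i * b i| ≤ |g i| * (2 * ν) := by
        rw [abs_mul]
        exact mul_le_mul_of_nonneg_left (hb i) (abs_nonneg _)
      linarith [neg_abs_le (g i * b i)]
    linarith
  · refine ⟨T (p j), ⟨_, hp j, rfl⟩, T (q j), ⟨_, hq j, rfl⟩, ?_, ?_, fun i hi => ?_⟩
    · simp [hT, b]
    · have := hpqi j
      simp only [hT, b, Pi.add_apply]
      linarith
    · have := congrFun (hpq j) i
      rw [Matrix.mulVec_sub, Pi.sub_apply, Pi.single_eq_of_ne hi] at this
      simp only [hT, Pi.add_apply]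
      linarith

/-- Convex bodies sufficiently close to the cube, other than parallelepipeds, can be illuminated
by `2 ^ n - 1` directions. -/
theorem exists_illuminable_of_support (n : ℕ) :
    ∃ ρ : ℝ, 0 < ρ ∧ ρ < 1 ∧ ∀ K : Set (Fin n → ℝ), Convex ℝ K → IsCompact K →
      (∀ x ∈ K, ∀ i, |x i| ≤ 1) →
      (∀ g : Fin n → ℝ, ∃ y ∈ K, (1 - ρ) * ∑ i, |g i| ≤ g ⬝ᵥ y) →
      ¬ (∃ T : (Fin n → ℝ) ≃ᵃ[ℝ] (Fin n → ℝ), K = T '' {y : Fin n → ℝ | ∀ i, |y i| ≤ 1}) →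
      Illuminable K (2 ^ n - 1) := by
  have hn : (0 : ℝ) ≤ n := Nat.cast_nonneg n
  set η : ℝ := 1 / (4000 * (n + 1) ^ 2) with hη
  have hη0 : 0 < η := by positivity
  have hη1 : η * (4000 * (n + 1) ^ 2) = 1 := by
    rw [hη]
    field_simp
  set ν : ℝ := η / 64 with hν
  have hν0 : 0 < ν := by positivity
  have hν1 : ν ≤ 1 / 8 := by
    have := mul_nonneg hη0.le hn
    have := mul_nonneg this hn
    linarith
  set μ : ℝ := ν / (3 * (4 / 3) ^ n) with hμ
  have hμ0 : 0 < μ := by positivity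
  have hμν : 3 * μ * (4 / 3) ^ n = ν := by
    rw [hμ]
    field_simp
  have hpow : (1 : ℝ) ≤ (4 / 3) ^ n := one_le_pow₀ (by norm_num)
  have hμ1 : μ ≤ ν := by nlinarith
  set ρ : ℝ := μ / (2 * (n + 1)) with hρ
  have hρ0 : 0 < ρ := by positivity
  have hρn : ρ * (2 * (n + 1)) = μ := by
    rw [hρ]
    field_simp
  have hρn0 := mul_nonneg hρ0.le hn
  have hρμ : ((1 - ρ)⁻¹) ^ n ≤ 1 + μ := by
    have h1 : 1 - n * ρ ≤ (1 - ρ) ^ n := by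
      have := one_add_mul_le_pow (a := -ρ) (by linarith) n
      rw [← sub_eq_add_neg] at this
      linarith
    rw [inv_pow, inv_le_iff_one_le_mul₀ (by apply pow_pos; linarith)]
    nlinarith
  refine ⟨ρ, hρ0, by linarith, fun K hK hKc hKQ hsup hpar => ?_⟩
  obtain ⟨T, hTK, hw⟩ := exists_affineEquiv_nearCube hρ0.le (by linarith) hρμ hμν.le hν1 hK hKc
    hKQ hsup
  refine Illuminable.of_image T (hTK.illuminable hη0 hη1.le (by linarith) (by linarith) hw
    fun h => hpar ⟨T.symm, ?_⟩)
  rw [← h, Set.image_image]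
  simp

end Normalization

section ApproximateSymmetry

variable {n : ℕ} {K : Set (Fin n → ℝ)} {α : ℝ}

/-- `K` contains the signed rearrangements of its points up to the factor `α`, in the form
"a linear functional which is at most one on `K` is at most `α` on all signed rearrangements". -/
theorem dotProduct_rearrange_le (hα : 1 ≤ α)
    (hsym : ∀ x ∈ K, ∀ σ : Equiv.Perm (Fin n), ∀ ε : Fin n → ℝ,
      (∀ i, ε i = 1 ∨ ε i = -1) → (fun i => ε i * x (σ i)) ∈ α • K) {f : Fin n → ℝ} {c : ℝ}
    (hf : ∀ y ∈ K, f ⬝ᵥ y ≤ c) {x : Fin n → ℝ} (hx : x ∈ K) (σ : Equiv.Perm (Fin n)) :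
    ∑ i, |f i| * |x (σ i)| ≤ α * c := by
  obtain ⟨y, hy, h⟩ := hsym x hx σ (fun i => if 0 ≤ f i * x (σ i) then 1 else -1)
    (fun i => by split_ifs <;> simp)
  have h1 : ∑ i, |f i| * |x (σ i)| = f ⬝ᵥ (α • y) := by
    rw [show α • y = _ from h]
    refine Finset.sum_congr rfl fun i _ => ?_
    dsimp only
    rw [← abs_mul]
    split_ifs with h
    · rw [abs_of_nonneg h]; ring
    · rw [abs_of_neg (not_le.1 h)]; ring
  rw [h1, dotProduct_smul, smul_eq_mul]
  exact mul_le_mul_of_nonneg_left (hf y hy) (by linarith)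

theorem abs_le_of_rearrange (hα : 1 ≤ α)
    (hsym : ∀ x ∈ K, ∀ σ : Equiv.Perm (Fin n), ∀ ε : Fin n → ℝ,
      (∀ i, ε i = 1 ∨ ε i = -1) → (fun i => ε i * x (σ i)) ∈ α • K) {f : Fin n → ℝ} {c : ℝ}
    (hf : ∀ y ∈ K, f ⬝ᵥ y ≤ c) {x : Fin n → ℝ} (hx : x ∈ K) {k : Fin n} (hk : |x k| = 1)
    (i : Fin n) : |f i| ≤ α * c := by
  refine le_trans ?_ (dotProduct_rearrange_le hα hsym hf hx (Equiv.swap i k))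
  have := Finset.single_le_sum (f := fun l => |f l| * |x (Equiv.swap i k l)|)
    (fun l _ => mul_nonneg (abs_nonneg _) (abs_nonneg _)) (Finset.mem_univ i)
  simpa [hk] using this

end ApproximateSymmetry

theorem exists_isMax_dotProduct {n : ℕ} {K : Set (Fin n → ℝ)} (hKc : IsCompact K)
    (hne : K.Nonempty) (g : Fin n → ℝ) : ∃ y ∈ K, ∀ z ∈ K, g ⬝ᵥ z ≤ g ⬝ᵥ y := by
  obtain ⟨y, hy, h⟩ := hKc.exists_isMaxOn (f := fun z => g ⬝ᵥ z) hne
    (Continuous.continuousOn (by unfold dotProduct; fun_prop))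
  exact ⟨y, hy, fun z hz => h hz⟩

theorem exists_illuminable_of_normalized {n : ℕ} (hn : 3 ≤ n) :
    ∃ α : ℝ, 1 < α ∧ ∀ K : Set (Fin n → ℝ), Convex ℝ K → IsCompact K →
      (∀ x ∈ K, ∀ i, |x i| ≤ 1) → (∃ z ∈ K, ∃ k, |z k| = 1) →
      (∀ x ∈ K, ∀ σ : Equiv.Perm (Fin n), ∀ ε : Fin n → ℝ,
        (∀ i, ε i = 1 ∨ ε i = -1) → (fun i => ε i * x (σ i)) ∈ α • K) →
      ¬ (∃ T : (Fin n → ℝ) ≃ᵃ[ℝ] (Fin n → ℝ), K = T '' {y : Fin n → ℝ | ∀ i, |y i| ≤ 1}) →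
      Illuminable K (2 ^ n - 1) := by
  obtain ⟨ρ, hρ, hρ1, hlarge⟩ := exists_illuminable_of_support n
  obtain ⟨η, hη, -, dir, hdir⟩ :=
    exists_direction_of_nearlyNormal hn (half_pos hρ) (by linarith : ρ / 2 ≤ 1)
  have hm : 0 < min η (ρ / 2) := lt_min hη (half_pos hρ)
  refine ⟨1 + min η (ρ / 2), by linarith, ?_⟩
  have hαη : 1 + min η (ρ / 2) ≤ 1 + η := by linarith [min_le_left η (ρ / 2)]
  have hαρ : 1 + min η (ρ / 2) ≤ 1 + ρ / 2 := by linarith [min_le_right η (ρ / 2)]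
  have hα1 : 1 ≤ 1 + min η (ρ / 2) := by linarith
  generalize 1 + min η (ρ / 2) = α at hαη hαρ hα1
  rintro K hK hKc hQ ⟨z, hz, k, hk⟩ hsym hnp
  have hmax := exists_isMax_dotProduct hKc ⟨z, hz⟩
  by_cases hcase : ∃ x ∈ K, ∀ i, 1 - ρ / 2 < |x i|
  · obtain ⟨x, hx, hxi⟩ := hcase
    refine hlarge K hK hKc hQ (fun g => ?_) hnp
    obtain ⟨y, hy, hyz⟩ := hmax g
    refine ⟨y, hy, ?_⟩
    have h1 := dotProduct_rearrange_le hα1 hsym hyz hx 1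
    have h2 : (1 - ρ / 2) * ∑ i, |g i| ≤ ∑ i, |g i| * |x ((1 : Equiv.Perm (Fin n)) i)| := by
      rw [Finset.mul_sum]
      refine Finset.sum_le_sum fun i _ => ?_
      rw [mul_comm]
      exact mul_le_mul_of_nonneg_left (hxi _).le (abs_nonneg _)
    have h3 : α * (1 - ρ) ≤ 1 - ρ / 2 := by nlinarith
    have h4 : 0 ≤ ∑ i, |g i| := Finset.sum_nonneg fun i _ => abs_nonneg _
    have h5 : α * ((1 - ρ) * ∑ i, |g i|) ≤ α * (g ⬝ᵥ y) := by nlinarith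
    exact le_of_mul_le_mul_left h5 (by linarith)
  · push Not at hcase
    have h0 : (0 : Fin n → ℝ) ∈ interior K := by
      have hnα : 0 < n * α := mul_pos (by exact_mod_cast (by omega : 0 < n)) (by linarith)
      refine zero_mem_interior_of_cube_subset (s := 1 / (n * α)) (by positivity)
        fun x hx => cube_subset_of_support hK hKc.isClosed (fun g => ?_) hx
      obtain ⟨y, hy, hyz⟩ := hmax g
      refine ⟨y, hy, ?_⟩
      have h1 : ∑ i, |g i| ≤ ∑ _i : Fin n, α * (g ⬝ᵥ y) :=
        Finset.sum_le_sum fun i _ => abs_le_of_rearrange hα1 hsym hyz hz hk i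
      rw [Finset.sum_const, Finset.card_univ, Fintype.card_fin, nsmul_eq_mul] at h1
      rw [one_div, inv_mul_le_iff₀ hnα]
      linarith
    classical
    refine ⟨(Finset.univ.erase fun _ => true).image dir, Finset.card_image_le.trans ?_,
      fun x hx => ?_⟩
    · rw [Finset.card_erase_of_mem (Finset.mem_univ _)]
      simp
    · have hxK := hKc.isClosed.frontier_subset hx
      obtain ⟨p, hp, hpf⟩ := hdir x (hQ x hxK) (hcase x hxK)
      refine ⟨dir p, Finset.mem_image_of_mem _ (Finset.mem_erase.2 ⟨hp, Finset.mem_univ _⟩),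
        illuminates_of_forall_normal hK hKc h0 hx fun f hfx hf => hpf f ⟨hfx, fun i => ?_,
          fun σ => ?_⟩⟩
      · linarith [abs_le_of_rearrange hα1 hsym hf hz hk i]
      · linarith [dotProduct_rearrange_le hα1 hsym hf hxK σ]

theorem exists_abs_eq_norm {n : ℕ} (hn : 0 < n) (z : Fin n → ℝ) : ∃ k, |z k| = ‖z‖ := by
  have : Nonempty (Fin n) := ⟨⟨0, hn⟩⟩
  obtain ⟨k, hk⟩ := Finite.exists_max fun i => |z i|
  exact ⟨k, le_antisymm (norm_le_pi_norm z k) ((pi_norm_le_iff_of_nonneg (abs_nonneg _)).2 hk)⟩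

theorem exists_norm_pos_of_nonempty_interior {n : ℕ} (hn : 0 < n) {K : Set (Fin n → ℝ)}
    (h : (interior K).Nonempty) : ∃ x ∈ K, 0 < ‖x‖ := by
  have : Nonempty (Fin n) := ⟨⟨0, hn⟩⟩
  by_contra! hcon
  have hK : K ⊆ {0} := fun x hx => norm_le_zero_iff.1 (hcon x hx)
  have := h.mono (interior_mono hK)
  rw [interior_singleton] at this
  exact Set.not_nonempty_empty this

/-- Theorem: for every `n ≥ 3` there is `α > 1` such that every `α`-symmetric convex body
in `ℝⁿ` which is not a parallelepiped has illumination number at most `2ⁿ - 1`. -/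
theorem stmt_19 {n : ℕ} (hn : 3 ≤ n) :
    ∃ α : ℝ, 1 < α ∧
      ∀ K : Set (Fin n → ℝ), Convex ℝ K → IsCompact K → (interior K).Nonempty →
        (∀ x ∈ K, ∀ σ : Equiv.Perm (Fin n), ∀ ε : Fin n → ℝ,
          (∀ i, ε i = 1 ∨ ε i = -1) → (fun i => ε i * x (σ i)) ∈ α • K) →
        ¬ (∃ T : (Fin n → ℝ) ≃ᵃ[ℝ] (Fin n → ℝ),
            K = T '' {y : Fin n → ℝ | ∀ i, |y i| ≤ 1}) →
        ∃ D : Finset (Fin n → ℝ), D.card ≤ 2 ^ n - 1 ∧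
          ∀ x ∈ frontier K, ∃ d ∈ D, ∃ ε : ℝ, 0 < ε ∧ x + ε • d ∈ interior K := by
  obtain ⟨α, hα, hill⟩ := exists_illuminable_of_normalized hn
  refine ⟨α, hα, fun K hK hKc hint hsym hnp => ?_⟩
  obtain ⟨x₀, hx₀, hpos⟩ := exists_norm_pos_of_nonempty_interior (by omega) hint
  obtain ⟨z, hz, hmax⟩ := hKc.exists_isMaxOn ⟨x₀, hx₀⟩ continuous_norm.continuousOn
  have hM : 0 < ‖z‖ := hpos.trans_le (hmax hx₀)
  obtain ⟨k, hk⟩ := exists_abs_eq_norm (by omega) z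
  let S : (Fin n → ℝ) ≃ᵃ[ℝ] (Fin n → ℝ) :=
    (LinearEquiv.smulOfNeZero ℝ (Fin n → ℝ) ‖z‖⁻¹ (inv_ne_zero hM.ne')).toAffineEquiv
  have hS : S '' K = ‖z‖⁻¹ • K := rfl
  refine Illuminable.of_image S (hS ▸ hill (‖z‖⁻¹ • K) (hK.smul _) (hKc.smul _) ?_ ?_ ?_ ?_)
  · rintro _ ⟨x, hx, rfl⟩ i
    have h : |x i| ≤ ‖z‖ := (norm_le_pi_norm x i).trans (hmax hx)
    simpa [abs_mul, inv_mul_le_iff₀ hM] using h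
  · exact ⟨‖z‖⁻¹ • z, Set.smul_mem_smul_set hz, k, by simp [abs_mul, hk, hM.ne']⟩
  · rintro _ ⟨x, hx, rfl⟩ σ ε hε
    rw [smul_comm]
    convert Set.smul_mem_smul_set (a := ‖z‖⁻¹) (hsym x hx σ ε hε) using 1
    ext i
    simp only [Pi.smul_apply, smul_eq_mul]
    ring
  · rintro ⟨T, hT⟩
    refine hnp ⟨T.trans S.symm, ?_⟩
    rw [AffineEquiv.coe_trans, Set.image_comp, ← hT, ← hS, ← Set.image_comp]
    simp
end
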